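/- Let n ≥ 1, let K ⊂ ℝ^n be compact, let μ0 be a Borel probability measure supported in K and absolutely continuous with respect to Lebesgue measure, μ1 a Borel probability measure supported in K, and let (κ_m) be a sequence of positive reals with κ_m → ∞. For each m let (v0^m, α0^m, (μ1^m)^⊥) be the HK logarithmic map components of μ1 at μ0 for parameter κ_m, and let v0 = T − id, where T is the (unique) optimal transport map for W2²(μ0,μ1), i.e., (id,T)_# μ0 is the unique optimal coupling. Then there exists M such that (μ1^m)^⊥ = 0 for all m ≥ M; moreover ∫ |v0^m − v0|² dμ0 → 0 and ∫ (α0^m)² dμ0 → 0 as m → ∞. -/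

import Mathlib

open MeasureTheory ENNReal Filter Topology RealInnerProductSpace
open scoped Classical

noncomputable section

abbrev Eucl (n : ℕ) : Type := EuclideanSpace ℝ (Fin n)

/-- Truncated cosine `Cos`. -/
def truncCos (s : ℝ) : ℝ := Real.cos (min |s| (Real.pi / 2))

/-- The Hellinger–Kantorovich cost function `c_κ`. -/
def cHK {n : ℕ} (κ : ℝ) (x y : Eucl n) : ℝ≥0∞ :=
  if dist x y < κ * Real.pi / 2 then
    ENNReal.ofReal (-2 * κ ^ 2 * Real.log (Real.cos (dist x y / κ)))
  else ⊤

/-- Kullback–Leibler divergence `KL(ρ|μ)`. -/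
def KLdiv {α : Type*} [MeasurableSpace α] (ρ μ : Measure α) : ℝ≥0∞ :=
  if ρ ≪ μ then
    ∫⁻ x, ENNReal.ofReal ((ρ.rnDeriv μ x).toReal * Real.log (ρ.rnDeriv μ x).toReal
      - (ρ.rnDeriv μ x).toReal + 1) ∂μ
  else ⊤

/-- The soft-marginal Hellinger–Kantorovich functional `E_κ(π|μ0,μ1)`. -/
def HKfun {n : ℕ} (κ : ℝ) (π : Measure (Eucl n × Eucl n)) (μ0 μ1 : Measure (Eucl n)) : ℝ≥0∞ :=
  ∫⁻ p, cHK κ p.1 p.2 ∂π + ENNReal.ofReal (κ ^ 2) * KLdiv (π.map Prod.fst) μ0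
    + ENNReal.ofReal (κ ^ 2) * KLdiv (π.map Prod.snd) μ1

/-- The squared Hellinger–Kantorovich distance `HK_κ²(μ0,μ1)`. -/
def HK2 {n : ℕ} (κ : ℝ) (μ0 μ1 : Measure (Eucl n)) : ℝ≥0∞ :=
  ⨅ (π : Measure (Eucl n × Eucl n)) (_ : IsFiniteMeasure π), HKfun κ π μ0 μ1

/-- The squared 2-Wasserstein distance `W2²(μ0,μ1)`. -/
def W2sq {n : ℕ} (μ0 μ1 : Measure (Eucl n)) : ℝ≥0∞ :=
  ⨅ (π : Measure (Eucl n × Eucl n))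
    (_ : π.map Prod.fst = μ0 ∧ π.map Prod.snd = μ1),
      ∫⁻ p, ENNReal.ofReal (dist p.1 p.2 ^ 2) ∂π

/-- Narrow convergence of a sequence of measures. -/
def NarrowTendsto {α : Type*} [MeasurableSpace α] [TopologicalSpace α]
    (ρ : ℕ → Measure α) (ρlim : Measure α) : Prop :=
  ∀ φ : BoundedContinuousFunction α ℝ,
    Tendsto (fun N => ∫ x, φ x ∂(ρ N)) atTop (𝓝 (∫ x, φ x ∂ρlim))

/-- The spherical Hellinger–Kantorovich distance `SHK_κ(μ0,μ1)`. -/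
def SHK {n : ℕ} (κ : ℝ) (μ0 μ1 : Measure (Eucl n)) : ℝ :=
  κ * Real.arccos (1 - (HK2 κ μ0 μ1).toReal / (2 * κ ^ 2))

/-- The square-root measure `√(ρσ)`. -/
def sqrtMeasure {α : Type*} [MeasurableSpace α] (ρ σ : Measure α) : Measure α :=
  (ρ + σ).withDensity (fun x => (ρ.rnDeriv (ρ + σ) x * σ.rnDeriv (ρ + σ) x) ^ (1/2 : ℝ))



/-- barycentric HK velocity. -/
def barV {n : ℕ} (κ : ℝ) (μ0 : Measure (Eucl n)) (π : Measure (Eucl n × Eucl n))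
    [IsFiniteMeasure π] (x : Eucl n) : Eucl n :=
  (κ * ((π.map Prod.fst).rnDeriv μ0 x).toReal) •
    ∫ y, (Real.tan (‖y - x‖ / κ) / ‖y - x‖) • (y - x) ∂(π.condKernel x)

/-- barycentric HK growth. -/
def barA {n : ℕ} (μ0 : Measure (Eucl n)) (π : Measure (Eucl n × Eucl n)) (x : Eucl n) : ℝ :=
  2 * (((π.map Prod.fst).rnDeriv μ0 x).toReal - 1)

/-- barycentric W2 velocity. -/
def barW {n : ℕ} (π : Measure (Eucl n × Eucl n)) [IsFiniteMeasure π] (x : Eucl n) : Eucl n :=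
  ∫ y, (y - x) ∂(π.condKernel x)

end

open InformationTheory

/-- The tangent line inequality for the convex function `klFun`. -/
lemma klFun_tangent_le {r s : ℝ} (hr : 0 < r) (hs : 0 ≤ s) :
    klFun r + Real.log r * (s - r) ≤ klFun s := by
  have h := klFun_nonneg (x := s / r) (by positivity)
  rcases hs.eq_or_lt with rfl | hs
  · simp only [klFun_apply]; nlinarith
  · rw [klFun_apply, Real.log_div hs.ne' hr.ne'] at h
    have h2 := mul_nonneg hr.le h
    have : r * (s / r * (Real.log s - Real.log r) + 1 - s / r)
        = s * (Real.log s - Real.log r) + r - s := by field_simp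
    rw [this] at h2
    simp only [klFun_apply]; nlinarith

lemma klFun_add_small_le {s t : ℝ} (hs : 0 ≤ s) (ht : 0 < t) (h : s + t ≤ Real.exp (-4)) :
    klFun (s + t) + 4 * t ≤ klFun s := by
  have h1 := klFun_tangent_le (r := s + t) (by positivity) hs
  have h2 : Real.log (s + t) ≤ -4 := (Real.log_le_iff_le_exp (by positivity)).2 h
  nlinarith

lemma klFun_add_le {s t : ℝ} (hs : 0 ≤ s) (ht : 0 < t) :
    klFun (s + t) ≤ klFun s + t * (s + t) := by
  have h1 := klFun_tangent_le (r := s + t) (by positivity) hs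
  have h2 := Real.log_le_self (x := s + t) (by positivity)
  nlinarith

lemma klFun_add_half_le {s t : ℝ} (hs : 0 ≤ s) (ht : 0 ≤ t) (h : Real.exp (-5) ≤ s + t) :
    klFun (s + t / 2) ≤ klFun (s + t) + 3 * t := by
  have he : 2 * Real.exp (-6) ≤ Real.exp (-5) := by
    rw [show (-5 : ℝ) = -6 + 1 by norm_num, Real.exp_add]
    have := Real.add_one_le_exp (1 : ℝ)
    nlinarith [Real.exp_pos (-6)]
  have h3 : Real.exp (-6) ≤ s + t / 2 := by linarith
  have hp : 0 < s + t / 2 := (Real.exp_pos _).trans_le h3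
  have h1 := klFun_tangent_le (r := s + t / 2) hp (s := s + t) (by positivity)
  have h2 : -6 ≤ Real.log (s + t / 2) := (Real.le_log_iff_exp_le hp).2 h3
  nlinarith

lemma klFun_half_le {s : ℝ} (h : 2 * Real.exp 7 ≤ s) :
    klFun (s / 2) + 7 / 2 * s ≤ klFun s := by
  have h3 : Real.exp 7 ≤ s / 2 := by linarith
  have hp : 0 < s / 2 := (Real.exp_pos _).trans_le h3
  have h1 := klFun_tangent_le (r := s / 2) hp (s := s) (by linarith)
  have h2 : 7 ≤ Real.log (s / 2) := (Real.le_log_iff_exp_le hp).2 h3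
  nlinarith

lemma abs_sub_one_le_klFun {s l : ℝ} (hs : 0 ≤ s) (hl : 0 < l) (hl1 : l ≤ 1) :
    |s - 1| ≤ klFun s / l + l := by
  have h1 := klFun_tangent_le (Real.exp_pos l) hs
  have h2 := klFun_tangent_le (Real.exp_pos (-l)) hs
  have h3 := Real.abs_exp_sub_one_sub_id_le (x := l) (by rwa [abs_of_pos hl])
  have h4 := Real.abs_exp_sub_one_sub_id_le (x := -l) (by rwa [abs_neg, abs_of_pos hl])
  simp only [klFun_apply, Real.log_exp] at h1 h2
  have h5 := (abs_le.1 h3).2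
  have h6 := (abs_le.1 h4).2
  rw [show klFun s / l + l = (klFun s + l ^ 2) / l by field_simp, le_div_iff₀ hl]
  simp only [klFun_apply]
  rcases abs_cases (s - 1) with ⟨h, _⟩ | ⟨h, _⟩ <;> rw [h] <;> nlinarith

section Density

variable {α : Type*} [MeasurableSpace α]

lemma withDensity_ofReal_rnDeriv {ρ μ : Measure α} [IsFiniteMeasure ρ] [SigmaFinite μ]
    (h : ρ ≪ μ) : μ.withDensity (fun x => ENNReal.ofReal (ρ.rnDeriv μ x).toReal) = ρ := by
  conv_rhs => rw [← Measure.withDensity_rnDeriv_eq ρ μ h]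
  refine withDensity_congr_ae ?_
  filter_upwards [ρ.rnDeriv_lt_top μ] with x hx
  exact ENNReal.ofReal_toReal hx.ne

lemma KLdiv_of_ac {ρ μ : Measure α} (h : ρ ≪ μ) :
    KLdiv ρ μ = ∫⁻ x, ENNReal.ofReal (klFun (ρ.rnDeriv μ x).toReal) ∂μ := by
  rw [KLdiv, if_pos h]
  refine lintegral_congr fun x => ?_
  rw [klFun_apply]; congr 1; ring

lemma KLdiv_ne_top_ac {ρ μ : Measure α} (h : KLdiv ρ μ ≠ ⊤) : ρ ≪ μ := by
  by_contra hc
  exact h (by rw [KLdiv, if_neg hc])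

lemma KLdiv_withDensity {μ : Measure α} [SigmaFinite μ] {f : α → ℝ} (hf : Measurable f)
    (hf0 : ∀ x, 0 ≤ f x) :
    KLdiv (μ.withDensity fun x => ENNReal.ofReal (f x)) μ
      = ∫⁻ x, ENNReal.ofReal (klFun (f x)) ∂μ := by
  rw [KLdiv_of_ac (withDensity_absolutelyContinuous _ _)]
  refine lintegral_congr_ae ?_
  filter_upwards [Measure.rnDeriv_withDensity μ hf.ennreal_ofReal] with x hx
  rw [hx, ENNReal.toReal_ofReal (hf0 x)]

lemma KLdiv_self (μ : Measure α) [SigmaFinite μ] : KLdiv μ μ = 0 := by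
  rw [KLdiv_of_ac Measure.AbsolutelyContinuous.rfl]
  rw [← lintegral_zero (μ := μ)]
  refine lintegral_congr_ae ?_
  filter_upwards [Measure.rnDeriv_self μ] with x hx
  simp [hx, klFun_one]

/-- A Pinsker-type bound. -/
lemma lintegral_abs_sub_one_le {μ : Measure α} [IsProbabilityMeasure μ] {f : α → ℝ}
    (hf : Measurable f) (hf0 : ∀ x, 0 ≤ f x) {l : ℝ} (hl : 0 < l) (hl1 : l ≤ 1) :
    ∫⁻ x, ENNReal.ofReal |f x - 1| ∂μ
      ≤ (∫⁻ x, ENNReal.ofReal (klFun (f x)) ∂μ) / ENNReal.ofReal l + ENNReal.ofReal l := by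
  calc ∫⁻ x, ENNReal.ofReal |f x - 1| ∂μ
      ≤ ∫⁻ x, (ENNReal.ofReal (klFun (f x)) / ENNReal.ofReal l + ENNReal.ofReal l) ∂μ := by
        refine lintegral_mono fun x => ?_
        rw [← ENNReal.ofReal_div_of_pos hl,
          ← ENNReal.ofReal_add (div_nonneg (klFun_nonneg (hf0 x)) hl.le) hl.le]
        exact ENNReal.ofReal_le_ofReal (abs_sub_one_le_klFun (hf0 x) hl hl1)
    _ = _ := by
        rw [lintegral_add_right _ measurable_const]
        simp only [div_eq_mul_inv, lintegral_const, measure_univ, mul_one]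
        have hm : Measurable fun x => klFun (f x) := measurable_klFun.comp hf
        rw [lintegral_mul_const _ hm.ennreal_ofReal]

end Density

lemma measurable_cHK {n : ℕ} (κ : ℝ) : Measurable fun p : Eucl n × Eucl n => cHK κ p.1 p.2 := by
  unfold cHK
  refine Measurable.ite (measurableSet_lt (by fun_prop) (by fun_prop)) ?_ measurable_const
  fun_prop

lemma HKfun_swap {n : ℕ} (κ : ℝ) (π : Measure (Eucl n × Eucl n)) (μ0 μ1 : Measure (Eucl n)) :
    HKfun κ (π.map Prod.swap) μ1 μ0 = HKfun κ π μ0 μ1 := by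
  unfold HKfun
  rw [lintegral_map (measurable_cHK κ) measurable_swap,
    Measure.map_map measurable_fst measurable_swap, Measure.map_map measurable_snd measurable_swap]
  simp only [Prod.fst_swap, Prod.snd_swap, Function.comp_def, cHK, dist_comm]
  ring

/-- Where the first marginal of a minimizer has small density, adding mass decreases the energy. -/
lemma exp_le_rnDeriv_of_isMin {n : ℕ} {κ : ℝ} (hκ : 0 < κ) {μ0 μ1 : Measure (Eucl n)}
    [IsProbabilityMeasure μ0] [IsProbabilityMeasure μ1]
    {π : Measure (Eucl n × Eucl n)} [IsFiniteMeasure π]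
    (hmin : ∀ π' : Measure (Eucl n × Eucl n), IsFiniteMeasure π' →
      HKfun κ π μ0 μ1 ≤ HKfun κ π' μ0 μ1)
    (hac0 : π.map Prod.fst ≪ μ0) (hac1 : π.map Prod.snd ≪ μ1)
    (hfin : HKfun κ π μ0 μ1 ≠ ⊤) (hmass : π Set.univ ≤ 2)
    (hc : ∀ᵐ p ∂(μ0.prod μ1), cHK κ p.1 p.2 ≤ ENNReal.ofReal (κ ^ 2)) :
    ∀ᵐ x ∂μ0, Real.exp (-5) ≤ ((π.map Prod.fst).rnDeriv μ0 x).toReal := by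
  set t : ℝ := Real.exp (-4) / 2 with ht
  have ht0 : 0 < t := by positivity
  have ht1 : t ≤ 1 / 2 := by
    have : Real.exp (-4) ≤ 1 := Real.exp_le_one_iff.2 (by norm_num)
    linarith
  have ht5 : Real.exp (-5) ≤ t := by
    have := Real.add_one_le_exp (1 : ℝ)
    rw [ht, show (-4 : ℝ) = -5 + 1 by norm_num, Real.exp_add]
    nlinarith [Real.exp_pos (-5)]
  set f : Eucl n → ℝ := fun x => ((π.map Prod.fst).rnDeriv μ0 x).toReal with hf
  set g : Eucl n → ℝ := fun x => ((π.map Prod.snd).rnDeriv μ1 x).toReal with hg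
  have hfm : Measurable f := (Measure.measurable_rnDeriv _ _).ennreal_toReal
  have hgm : Measurable g := (Measure.measurable_rnDeriv _ _).ennreal_toReal
  have hf0 : ∀ x, 0 ≤ f x := fun x => ENNReal.toReal_nonneg
  have hg0 : ∀ x, 0 ≤ g x := fun x => ENNReal.toReal_nonneg
  have hfd : μ0.withDensity (fun x => ENNReal.ofReal (f x)) = π.map Prod.fst :=
    withDensity_ofReal_rnDeriv hac0
  have hgd : μ1.withDensity (fun x => ENNReal.ofReal (g x)) = π.map Prod.snd :=
    withDensity_ofReal_rnDeriv hac1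
  set A : Set (Eucl n) := {x | f x ≤ t} with hA
  have hAm : MeasurableSet A := measurableSet_le hfm measurable_const
  suffices hA0 : μ0 A = 0 by
    have : ∀ᵐ x ∂μ0, x ∉ A := measure_eq_zero_iff_ae_notMem.1 hA0
    filter_upwards [this] with x hx
    exact ht5.trans (not_le.1 hx).le
  by_contra hA0
  set a : ℝ := (μ0 A).toReal with ha
  have hatop : μ0 A ≠ ⊤ := measure_ne_top _ _
  have ha0 : 0 < a := ENNReal.toReal_pos hA0 hatop
  have haA : μ0 A = ENNReal.ofReal a := (ENNReal.ofReal_toReal hatop).symm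
  have ha1 : a ≤ 1 := by
    have : μ0 A ≤ 1 := prob_le_one
    exact ENNReal.toReal_le_of_le_ofReal zero_le_one (by simpa using this)
  -- the competitor
  set π' : Measure (Eucl n × Eucl n) := π + ENNReal.ofReal t • (μ0.restrict A).prod μ1 with hπ'
  have hfin' : IsFiniteMeasure π' := by
    have : IsFiniteMeasure (ENNReal.ofReal t • (μ0.restrict A).prod μ1) :=
      Measure.smul_finite _ ENNReal.ofReal_ne_top
    infer_instance
  have hfst : π'.map Prod.fst
      = μ0.withDensity (fun x => ENNReal.ofReal (f x + A.indicator (fun _ => t) x)) := by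
    rw [hπ', Measure.map_add _ _ measurable_fst, Measure.map_smul, Measure.map_fst_prod,
      measure_univ, one_smul, ← hfd]
    have : ENNReal.ofReal t • μ0.restrict A
        = μ0.withDensity (fun x => ENNReal.ofReal (A.indicator (fun _ => t) x)) := by
      have h2 : (fun x => ENNReal.ofReal (A.indicator (fun _ => t) x))
          = A.indicator (fun _ => ENNReal.ofReal t) := by
        ext x; by_cases hx : x ∈ A <;> simp [hx]
      rw [h2, withDensity_indicator hAm, withDensity_const]
    rw [this, ← withDensity_add_left hfm.ennreal_ofReal]
    congr 1
    ext x
    exact (ENNReal.ofReal_add (hf0 x) (Set.indicator_nonneg (fun _ _ => ht0.le) x)).symm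
  have hsnd : π'.map Prod.snd = μ1.withDensity (fun x => ENNReal.ofReal (g x + t * a)) := by
    rw [hπ', Measure.map_add _ _ measurable_snd, Measure.map_smul, Measure.map_snd_prod,
      Measure.restrict_apply_univ, haA, smul_smul, ← ENNReal.ofReal_mul ht0.le, ← hgd]
    rw [← withDensity_const, ← withDensity_add_left hgm.ennreal_ofReal]
    congr 1
    ext x
    exact (ENNReal.ofReal_add (hg0 x) (by positivity)).symm
  have hI : ∫⁻ p, cHK κ p.1 p.2 ∂π' ≤ ∫⁻ p, cHK κ p.1 p.2 ∂π + ENNReal.ofReal (t * a * κ ^ 2) := by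
    rw [hπ', lintegral_add_measure, lintegral_smul_measure]
    gcongr
    have hle : (μ0.restrict A).prod μ1 ≤ μ0.prod μ1 := by
      have h2 : (μ0.restrict A).prod μ1 = (μ0.prod μ1).restrict (A ×ˢ Set.univ) := by
        rw [← Measure.prod_restrict, Measure.restrict_univ]
      rw [h2]; exact Measure.restrict_le_self
    calc ENNReal.ofReal t • ∫⁻ p, cHK κ p.1 p.2 ∂(μ0.restrict A).prod μ1
        ≤ ENNReal.ofReal t • ∫⁻ p, ENNReal.ofReal (κ ^ 2) ∂(μ0.restrict A).prod μ1 := by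
          gcongr 1
          exact lintegral_mono_ae (ae_mono hle hc)
      _ = ENNReal.ofReal (t * a * κ ^ 2) := by
          rw [lintegral_const, ← Set.univ_prod_univ, Measure.prod_prod,
            Measure.restrict_apply_univ, measure_univ, haA, mul_one, smul_eq_mul,
            ENNReal.ofReal_mul (by positivity), ENNReal.ofReal_mul ht0.le]
          ring
  have hK0 : KLdiv (π'.map Prod.fst) μ0 + ENNReal.ofReal (4 * t * a) ≤ KLdiv (π.map Prod.fst) μ0 := by
    rw [hfst, ← hfd, KLdiv_withDensity hfm hf0, KLdiv_withDensity
      (f := fun x => f x + A.indicator (fun _ => t) x) (hfm.add (measurable_const.indicator hAm))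
      (fun x => add_nonneg (hf0 x) (Set.indicator_nonneg (fun _ _ => ht0.le) x))]
    have h2 : ENNReal.ofReal (4 * t * a) = ∫⁻ x, A.indicator (fun _ => ENNReal.ofReal (4 * t)) x ∂μ0 := by
      rw [lintegral_indicator_const hAm, haA, ENNReal.ofReal_mul (by positivity)]
    rw [h2, ← lintegral_add_right _ (measurable_const.indicator hAm)]
    refine lintegral_mono fun x => ?_
    by_cases hx : x ∈ A
    · simp only [hx, Set.indicator_of_mem]
      rw [← ENNReal.ofReal_add (klFun_nonneg (add_nonneg (hf0 x) ht0.le)) (by positivity)]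
      refine ENNReal.ofReal_le_ofReal (klFun_add_small_le (hf0 x) ht0 ?_)
      have : f x ≤ t := hx
      linarith
    · simp [hx]
  have hgint : ∫⁻ x, ENNReal.ofReal (g x) ∂μ1 ≤ 2 := by
    have : ∫⁻ x, ENNReal.ofReal (g x) ∂μ1 = π Set.univ := by
      rw [← setLIntegral_univ, ← withDensity_apply _ MeasurableSet.univ, hgd,
        Measure.map_apply measurable_snd MeasurableSet.univ, Set.preimage_univ]
    rw [this]; exact hmass
  have hta : t * a ≤ 1 / 2 := by nlinarith
  have hK1 : KLdiv (π'.map Prod.snd) μ1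
      ≤ KLdiv (π.map Prod.snd) μ1 + ENNReal.ofReal (t * a * (5 / 2)) := by
    rw [hsnd, ← hgd, KLdiv_withDensity hgm hg0, KLdiv_withDensity (hgm.add_const _)
      (fun x => add_nonneg (hg0 x) (by positivity))]
    calc ∫⁻ x, ENNReal.ofReal (klFun (g x + t * a)) ∂μ1
        ≤ ∫⁻ x, (ENNReal.ofReal (klFun (g x))
            + ENNReal.ofReal (t * a) * (ENNReal.ofReal (g x) + ENNReal.ofReal (1 / 2))) ∂μ1 := by
          refine lintegral_mono fun x => ?_
          have := hg0 x
          rw [← ENNReal.ofReal_add (hg0 x) (by positivity), ← ENNReal.ofReal_mul (by positivity),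
            ← ENNReal.ofReal_add (klFun_nonneg (hg0 x)) (by positivity)]
          refine ENNReal.ofReal_le_ofReal ((klFun_add_le (hg0 x) (by positivity)).trans ?_)
          gcongr
      _ ≤ _ := by
          rw [lintegral_add_right _ (by fun_prop), lintegral_const_mul _ (by fun_prop),
            lintegral_add_right _ measurable_const, lintegral_const, measure_univ, mul_one,
            ENNReal.ofReal_mul (p := t * a) (by positivity)]
          gcongr
          calc _ ≤ (2 : ℝ≥0∞) + ENNReal.ofReal (1 / 2) := by gcongr
            _ = ENNReal.ofReal (5 / 2) := by
              rw [show (2 : ℝ≥0∞) = ENNReal.ofReal 2 by simp,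
                ← ENNReal.ofReal_add (by norm_num) (by norm_num)]
              norm_num
  have hE := hmin π' hfin'
  have hκ2 : 0 < κ ^ 2 := by positivity
  unfold HKfun at hE hfin
  rw [ENNReal.add_ne_top, ENNReal.add_ne_top] at hfin
  obtain ⟨⟨hIf, hk0f⟩, hk1f⟩ := hfin
  have hk2 : ENNReal.ofReal (κ ^ 2) ≠ 0 := by simpa using hκ.ne'
  have hA0f : KLdiv (π.map Prod.fst) μ0 ≠ ⊤ := fun h => hk0f (by rw [h, ENNReal.mul_top hk2])
  have hB0f : KLdiv (π.map Prod.snd) μ1 ≠ ⊤ := fun h => hk1f (by rw [h, ENNReal.mul_top hk2])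
  have hA1f : KLdiv (π'.map Prod.fst) μ0 ≠ ⊤ := ne_top_of_le_ne_top hA0f (le_self_add.trans hK0)
  have hE2 := hE.trans (add_le_add (add_le_add hI le_rfl) (mul_le_mul_right hK1 _))
  clear hE hI hK1
  lift ∫⁻ p, cHK κ p.1 p.2 ∂π to NNReal using hIf with I
  lift KLdiv (π.map Prod.fst) μ0 to NNReal using hA0f with A0
  lift KLdiv (π.map Prod.snd) μ1 to NNReal using hB0f with B0
  lift KLdiv (π'.map Prod.fst) μ0 to NNReal using hA1f with A1
  simp only [← ENNReal.ofReal_coe_nnreal] at hE2 hK0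
  have hta0 : 0 < t * a := by positivity
  rw [← ENNReal.ofReal_add (by positivity) (by positivity), ENNReal.ofReal_le_ofReal_iff (by positivity)] at hK0
  rw [← ENNReal.ofReal_add (by positivity) (by positivity),
    ← ENNReal.ofReal_add (by positivity) (by positivity),
    ← ENNReal.ofReal_mul (by positivity), ← ENNReal.ofReal_mul (by positivity),
    ← ENNReal.ofReal_mul (by positivity), ← ENNReal.ofReal_mul (by positivity),
    ← ENNReal.ofReal_add (by positivity) (by positivity),
    ← ENNReal.ofReal_add (by positivity) (by positivity),
    ← ENNReal.ofReal_add (by positivity) (by positivity),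
    ← ENNReal.ofReal_add (by positivity) (by positivity),
    ENNReal.ofReal_le_ofReal_iff (by positivity)] at hE2
  have := mul_pos hκ2 hta0
  nlinarith [mul_le_mul_of_nonneg_left hK0 hκ2.le]

/-- Where the first marginal of a minimizer has large density, removing mass decreases the energy,
provided that the density of the second marginal is bounded below. -/
lemma rnDeriv_le_exp_of_isMin {n : ℕ} {κ : ℝ} (hκ : 0 < κ) {μ0 μ1 : Measure (Eucl n)}
    [IsProbabilityMeasure μ0] [IsProbabilityMeasure μ1]
    {π : Measure (Eucl n × Eucl n)} [IsFiniteMeasure π]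
    (hmin : ∀ π' : Measure (Eucl n × Eucl n), IsFiniteMeasure π' →
      HKfun κ π μ0 μ1 ≤ HKfun κ π' μ0 μ1)
    (hac0 : π.map Prod.fst ≪ μ0) (hac1 : π.map Prod.snd ≪ μ1)
    (hfin : HKfun κ π μ0 μ1 ≠ ⊤)
    (hlow : ∀ᵐ y ∂μ1, Real.exp (-5) ≤ ((π.map Prod.snd).rnDeriv μ1 y).toReal) :
    ∀ᵐ x ∂μ0, ((π.map Prod.fst).rnDeriv μ0 x).toReal ≤ 2 * Real.exp 7 := by
  set f : Eucl n → ℝ := fun x => ((π.map Prod.fst).rnDeriv μ0 x).toReal with hf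
  have hfm : Measurable f := (Measure.measurable_rnDeriv _ _).ennreal_toReal
  have hf0 : ∀ x, 0 ≤ f x := fun x => ENNReal.toReal_nonneg
  have hfd : μ0.withDensity (fun x => ENNReal.ofReal (f x)) = π.map Prod.fst :=
    withDensity_ofReal_rnDeriv hac0
  set A : Set (Eucl n) := {x | 2 * Real.exp 7 < f x} with hA
  have hAm : MeasurableSet A := measurableSet_lt measurable_const hfm
  set B : Set (Eucl n × Eucl n) := Prod.fst ⁻¹' A with hB
  have hBm : MeasurableSet B := measurable_fst hAm
  set b : ℝ := (π B).toReal with hb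
  have hbtop : π B ≠ ⊤ := measure_ne_top _ _
  have hbB : π B = ENNReal.ofReal b := (ENNReal.ofReal_toReal hbtop).symm
  have hbA : ∫⁻ x, A.indicator (fun x => ENNReal.ofReal (f x)) x ∂μ0 = ENNReal.ofReal b := by
    rw [lintegral_indicator hAm, ← withDensity_apply _ hAm, hfd,
      Measure.map_apply measurable_fst hAm, hbB]
  suffices hb0 : b ≤ 0 by
    rw [ENNReal.ofReal_of_nonpos hb0,
      lintegral_eq_zero_iff (hfm.ennreal_ofReal.indicator hAm)] at hbA
    filter_upwards [hbA] with x hx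
    by_contra hcon
    have hxA : x ∈ A := not_le.1 hcon
    have h2 : f x ≤ 0 := by simpa [hxA] using hx
    have := Real.exp_pos 7
    linarith
  by_contra! hb0
  -- the competitor
  set ρ := π.restrict B with hρ
  set ρc := π.restrict Bᶜ with hρc
  have hsum : ρc + ρ = π := by rw [add_comm]; exact Measure.restrict_add_restrict_compl hBm
  set π' : Measure (Eucl n × Eucl n) := ρc + ENNReal.ofReal (1 / 2) • ρ with hπ'
  have hfin' : IsFiniteMeasure π' := by
    have : IsFiniteMeasure (ENNReal.ofReal (1 / 2) • ρ) :=
      Measure.smul_finite _ ENNReal.ofReal_ne_top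
    infer_instance
  have hI : ∫⁻ p, cHK κ p.1 p.2 ∂π' ≤ ∫⁻ p, cHK κ p.1 p.2 ∂π := by
    rw [← hsum, hπ', lintegral_add_measure, lintegral_add_measure, lintegral_smul_measure]
    gcongr
    refine mul_le_of_le_one_left' ?_
    exact ENNReal.ofReal_le_one.2 (by norm_num)
  have hfst : π'.map Prod.fst
      = μ0.withDensity (fun x => ENNReal.ofReal (if x ∈ A then f x / 2 else f x)) := by
    rw [hπ', Measure.map_add _ _ measurable_fst, Measure.map_smul, hρ, hρc, hB,
      ← Set.preimage_compl, ← Measure.restrict_map measurable_fst hAm,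
      ← Measure.restrict_map measurable_fst hAm.compl, ← hfd, restrict_withDensity hAm,
      restrict_withDensity hAm.compl, ← withDensity_indicator hAm,
      ← withDensity_indicator hAm.compl, ← withDensity_smul _ (hfm.ennreal_ofReal.indicator hAm),
      ← withDensity_add_left (hfm.ennreal_ofReal.indicator hAm.compl)]
    congr 1
    ext x
    by_cases hx : x ∈ A
    · simp only [Pi.add_apply, Pi.smul_apply, hx, Set.indicator_of_mem, if_true,
        Set.mem_compl_iff, not_true_eq_false, not_false_eq_true, Set.indicator_of_notMem, zero_add,
        smul_eq_mul]
      rw [← ENNReal.ofReal_mul (by norm_num)]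
      congr 1; ring
    · simp [hx]
  have hK0 : KLdiv (π'.map Prod.fst) μ0 + ENNReal.ofReal (7 / 2 * b) ≤ KLdiv (π.map Prod.fst) μ0 := by
    rw [hfst, ← hfd, KLdiv_withDensity hfm hf0, KLdiv_withDensity
      (f := fun x => if x ∈ A then f x / 2 else f x)
      (Measurable.ite hAm (hfm.div_const _) hfm)
      (fun x => by have := hf0 x; split_ifs <;> positivity)]
    rw [ENNReal.ofReal_mul (by norm_num), ← hbA,
      ← lintegral_const_mul _ (hfm.ennreal_ofReal.indicator hAm),
      ← lintegral_add_right _ ((hfm.ennreal_ofReal.indicator hAm).const_mul _)]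
    refine lintegral_mono fun x => ?_
    have := hf0 x
    by_cases hx : x ∈ A
    · simp only [hx, Set.indicator_of_mem, if_true]
      rw [← ENNReal.ofReal_mul (by norm_num),
        ← ENNReal.ofReal_add (klFun_nonneg (by positivity)) (by positivity)]
      exact ENNReal.ofReal_le_ofReal (klFun_half_le (le_of_lt hx))
    · simp [hx]
  have hlec : ρc.map Prod.snd ≪ μ1 :=
    (Measure.AbsolutelyContinuous.map Measure.restrict_le_self.absolutelyContinuous
      measurable_snd).trans hac1
  have hle : ρ.map Prod.snd ≪ μ1 :=
    (Measure.AbsolutelyContinuous.map Measure.restrict_le_self.absolutelyContinuous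
      measurable_snd).trans hac1
  set u : Eucl n → ℝ := fun x => ((ρc.map Prod.snd).rnDeriv μ1 x).toReal with hu
  set v : Eucl n → ℝ := fun x => ((ρ.map Prod.snd).rnDeriv μ1 x).toReal with hv
  have hum : Measurable u := (Measure.measurable_rnDeriv _ _).ennreal_toReal
  have hvm : Measurable v := (Measure.measurable_rnDeriv _ _).ennreal_toReal
  have hu0 : ∀ x, 0 ≤ u x := fun x => ENNReal.toReal_nonneg
  have hv0 : ∀ x, 0 ≤ v x := fun x => ENNReal.toReal_nonneg
  have hud : μ1.withDensity (fun x => ENNReal.ofReal (u x)) = ρc.map Prod.snd :=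
    withDensity_ofReal_rnDeriv hlec
  have hvd : μ1.withDensity (fun x => ENNReal.ofReal (v x)) = ρ.map Prod.snd :=
    withDensity_ofReal_rnDeriv hle
  have hsnd : π.map Prod.snd = μ1.withDensity (fun x => ENNReal.ofReal (u x + v x)) := by
    rw [← hsum, Measure.map_add _ _ measurable_snd, ← hud, ← hvd,
      ← withDensity_add_left hum.ennreal_ofReal]
    congr 1
    ext x
    exact (ENNReal.ofReal_add (hu0 x) (hv0 x)).symm
  have hsnd' : π'.map Prod.snd = μ1.withDensity (fun x => ENNReal.ofReal (u x + v x / 2)) := by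
    rw [hπ', Measure.map_add _ _ measurable_snd, Measure.map_smul, ← hud, ← hvd,
      ← withDensity_smul _ hvm.ennreal_ofReal, ← withDensity_add_left hum.ennreal_ofReal]
    congr 1
    ext x
    have := hv0 x
    rw [ENNReal.ofReal_add (hu0 x) (by positivity), Pi.add_apply, Pi.smul_apply, smul_eq_mul,
      ← ENNReal.ofReal_mul (by norm_num)]
    congr 2; ring
  have hlow' : ∀ᵐ y ∂μ1, Real.exp (-5) ≤ u y + v y := by
    rw [hsnd] at hlow
    filter_upwards [hlow, Measure.rnDeriv_withDensity μ1 (hum.add hvm).ennreal_ofReal] with y h1 h2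
    have h3 : ((μ1.withDensity fun x => ENNReal.ofReal (u x + v x)).rnDeriv μ1 y)
      = ENNReal.ofReal (u y + v y) := h2
    rwa [h3, ENNReal.toReal_ofReal (add_nonneg (hu0 y) (hv0 y))] at h1
  have hvint : ∫⁻ x, ENNReal.ofReal (v x) ∂μ1 = ENNReal.ofReal b := by
    rw [← setLIntegral_univ, ← withDensity_apply _ MeasurableSet.univ, hvd,
      Measure.map_apply measurable_snd MeasurableSet.univ, Set.preimage_univ, hρ,
      Measure.restrict_apply_univ, hbB]
  have hK1 : KLdiv (π'.map Prod.snd) μ1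
      ≤ KLdiv (π.map Prod.snd) μ1 + ENNReal.ofReal (3 * b) := by
    rw [hsnd, hsnd', KLdiv_withDensity (f := fun x => u x + v x) (hum.add hvm) (fun x => add_nonneg (hu0 x) (hv0 x)),
      KLdiv_withDensity (f := fun x => u x + v x / 2) (hum.add (hvm.div_const _))
      (fun x => add_nonneg (hu0 x) (by have := hv0 x; positivity)),
      ENNReal.ofReal_mul (by norm_num), ← hvint, ← lintegral_const_mul _ hvm.ennreal_ofReal,
      ← lintegral_add_right _ (hvm.ennreal_ofReal.const_mul _)]
    refine lintegral_mono_ae ?_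
    filter_upwards [hlow'] with x hx
    have h1 := hu0 x
    have h2 := hv0 x
    rw [← ENNReal.ofReal_mul (by norm_num),
      ← ENNReal.ofReal_add (klFun_nonneg (add_nonneg h1 h2)) (by positivity)]
    exact ENNReal.ofReal_le_ofReal (klFun_add_half_le h1 h2 hx)
  have hE := hmin π' hfin'
  have hκ2 : 0 < κ ^ 2 := by positivity
  unfold HKfun at hE hfin
  rw [ENNReal.add_ne_top, ENNReal.add_ne_top] at hfin
  obtain ⟨⟨hIf, hk0f⟩, hk1f⟩ := hfin
  have hk2 : ENNReal.ofReal (κ ^ 2) ≠ 0 := by simpa using hκ.ne'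
  have hA0f : KLdiv (π.map Prod.fst) μ0 ≠ ⊤ := fun h => hk0f (by rw [h, ENNReal.mul_top hk2])
  have hB0f : KLdiv (π.map Prod.snd) μ1 ≠ ⊤ := fun h => hk1f (by rw [h, ENNReal.mul_top hk2])
  have hA1f : KLdiv (π'.map Prod.fst) μ0 ≠ ⊤ := ne_top_of_le_ne_top hA0f (le_self_add.trans hK0)
  have hE2 := hE.trans (add_le_add (add_le_add hI le_rfl) (mul_le_mul_right hK1 _))
  clear hE hI hK1
  lift ∫⁻ p, cHK κ p.1 p.2 ∂π to NNReal using hIf with I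
  lift KLdiv (π.map Prod.fst) μ0 to NNReal using hA0f with A0
  lift KLdiv (π.map Prod.snd) μ1 to NNReal using hB0f with B0
  lift KLdiv (π'.map Prod.fst) μ0 to NNReal using hA1f with A1
  simp only [← ENNReal.ofReal_coe_nnreal] at hE2 hK0
  rw [← ENNReal.ofReal_add (by positivity) (by positivity),
    ENNReal.ofReal_le_ofReal_iff (by positivity)] at hK0
  rw [← ENNReal.ofReal_add (by positivity) (by positivity),
    ← ENNReal.ofReal_mul (by positivity), ← ENNReal.ofReal_mul (by positivity),
    ← ENNReal.ofReal_mul (by positivity), ← ENNReal.ofReal_mul (by positivity),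
    ← ENNReal.ofReal_add (by positivity) (by positivity),
    ← ENNReal.ofReal_add (by positivity) (by positivity),
    ← ENNReal.ofReal_add (by positivity) (by positivity),
    ← ENNReal.ofReal_add (by positivity) (by positivity),
    ENNReal.ofReal_le_ofReal_iff (by positivity)] at hE2
  have := mul_pos hκ2 hb0
  nlinarith [mul_le_mul_of_nonneg_left hK0 hκ2.le]

section Cost

variable {n : ℕ} {κ D : ℝ} {x y : Eucl n}

lemma cHK_le (hκ : 0 < κ) (hd : dist x y ≤ D) (hD : D / κ < Real.pi / 2) :
    cHK κ x y ≤ ENNReal.ofReal (Real.cos (D / κ))⁻¹ * ENNReal.ofReal (dist x y ^ 2) := by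
  have hd0 : 0 ≤ dist x y := dist_nonneg
  have hlt : dist x y < κ * Real.pi / 2 := by
    rw [div_lt_iff₀ hκ] at hD; linarith
  have hs : dist x y / κ ≤ D / κ := by gcongr
  have hs0 : 0 ≤ dist x y / κ := by positivity
  have hcD : 0 < Real.cos (D / κ) := Real.cos_pos_of_mem_Ioo ⟨by linarith [Real.pi_pos], hD⟩
  have hcs : Real.cos (D / κ) ≤ Real.cos (dist x y / κ) :=
    Real.cos_le_cos_of_nonneg_of_le_pi hs0 (by linarith [Real.pi_pos]) hs
  rw [cHK, if_pos hlt, ← ENNReal.ofReal_mul (by positivity)]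
  refine ENNReal.ofReal_le_ofReal ?_
  set s := dist x y / κ with hsdef
  have hds : dist x y = κ * s := by rw [hsdef]; field_simp
  have hc : 0 < Real.cos s := hcD.trans_le hcs
  have h1 := Real.one_sub_inv_le_log_of_pos hc
  have h2 := Real.one_sub_sq_div_two_le_cos (x := s)
  have h3 : (Real.cos s)⁻¹ - 1 ≤ s ^ 2 / 2 * (Real.cos s)⁻¹ := by
    have : (Real.cos s)⁻¹ - 1 = (1 - Real.cos s) * (Real.cos s)⁻¹ := by field_simp
    rw [this]
    gcongr
    linarith
  have h4 : (Real.cos s)⁻¹ ≤ (Real.cos (D / κ))⁻¹ := by gcongr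
  have h5 : s ^ 2 / 2 * (Real.cos s)⁻¹ ≤ s ^ 2 / 2 * (Real.cos (D / κ))⁻¹ := by gcongr
  rw [hds]
  nlinarith [mul_le_mul_of_nonneg_left (show -2 * Real.log (Real.cos s) ≤
    s ^ 2 * (Real.cos (D / κ))⁻¹ by linarith) (sq_nonneg κ)]

lemma sq_dist_le_cHK (hκ : 0 < κ) (hd : dist x y ≤ D) :
    ENNReal.ofReal (dist x y ^ 2) ≤ ENNReal.ofReal (1 + (D / κ) ^ 2) * cHK κ x y := by
  have hd0 : 0 ≤ dist x y := dist_nonneg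
  unfold cHK
  split_ifs with hlt
  · rw [← ENNReal.ofReal_mul (by positivity)]
    refine ENNReal.ofReal_le_ofReal ?_
    have hs : dist x y / κ ≤ D / κ := by gcongr
    have hs0 : 0 ≤ dist x y / κ := by positivity
    have hs1 : dist x y / κ < Real.pi / 2 := by rw [div_lt_iff₀ hκ]; linarith
    set s := dist x y / κ with hsdef
    have hds : dist x y = κ * s := by rw [hsdef]; field_simp
    have hc : 0 < Real.cos s := Real.cos_pos_of_mem_Ioo ⟨by linarith [Real.pi_pos], hs1⟩
    have h1 := Real.cos_le_one_div_sqrt_sq_add_one (x := s) (by linarith [Real.pi_pos])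
      (by linarith [Real.pi_pos])
    have h2 := Real.log_le_log hc h1
    have hp : 0 < s ^ 2 + 1 := by positivity
    rw [Real.log_div one_ne_zero (by positivity), Real.log_one, Real.log_sqrt hp.le] at h2
    have h3 := Real.one_sub_inv_le_log_of_pos hp
    have h4 : 1 - (s ^ 2 + 1)⁻¹ ≤ -2 * Real.log (Real.cos s) := by linarith
    have h5 : s ^ 2 = (1 + s ^ 2) * (1 - (s ^ 2 + 1)⁻¹) := by field_simp; ring
    have h6 : s ^ 2 ≤ (1 + (D / κ) ^ 2) * (-2 * Real.log (Real.cos s)) := by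
      rw [h5]
      have h0 : 0 ≤ 1 - (s ^ 2 + 1)⁻¹ := by
        have : (s ^ 2 + 1)⁻¹ ≤ 1 := inv_le_one_of_one_le₀ (by nlinarith)
        linarith
      gcongr
    rw [hds]
    nlinarith [mul_le_mul_of_nonneg_left h6 (sq_nonneg κ)]
  · rw [ENNReal.mul_top (by simpa using by positivity)]
    exact le_top

lemma abs_tan_div_sub_one_le {s a : ℝ} (hs : 0 < s) (hsa : s ≤ a) (ha : a < Real.pi / 2) :
    |Real.tan s / s - 1| ≤ (Real.cos a)⁻¹ - 1 := by
  have hpi := Real.pi_pos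
  have hca : 0 < Real.cos a := Real.cos_pos_of_mem_Ioo ⟨by linarith, ha⟩
  have hcs : Real.cos a ≤ Real.cos s :=
    Real.cos_le_cos_of_nonneg_of_le_pi hs.le (by linarith) hsa
  have hc : 0 < Real.cos s := hca.trans_le hcs
  have h1 : 1 ≤ Real.tan s / s := by
    rw [le_div_iff₀ hs, one_mul]
    exact (Real.lt_tan hs (by linarith)).le
  rw [abs_of_nonneg (by linarith)]
  have h2 : Real.tan s / s ≤ (Real.cos a)⁻¹ := by
    rw [div_le_iff₀ hs, Real.tan_eq_sin_div_cos, div_eq_inv_mul]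
    have h3 := Real.sin_le hs.le
    have h4 : 0 ≤ Real.sin s := Real.sin_nonneg_of_nonneg_of_le_pi hs.le (by linarith)
    gcongr
  linarith

end Cost

/-- Replacing `μ` by `f μ` changes integrals of functions bounded by `C` by at most
`C ∫ |f - 1| dμ`. -/
lemma lintegral_le_lintegral_withDensity_add {α : Type*} [MeasurableSpace α] {μ : Measure α}
    {f : α → ℝ} (hf : Measurable f) (hf0 : ∀ x, 0 ≤ f x) {h : α → ℝ≥0∞}
    (hh : Measurable h) {C : ℝ≥0∞} (hC : ∀ᵐ x ∂μ, h x ≤ C) :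
    ∫⁻ x, h x ∂μ ≤ ∫⁻ x, h x ∂(μ.withDensity fun x => ENNReal.ofReal (f x))
        + C * ∫⁻ x, ENNReal.ofReal |f x - 1| ∂μ ∧
    ∫⁻ x, h x ∂(μ.withDensity fun x => ENNReal.ofReal (f x)) ≤ ∫⁻ x, h x ∂μ
        + C * ∫⁻ x, ENNReal.ofReal |f x - 1| ∂μ := by
  have hm : Measurable fun x => ENNReal.ofReal |f x - 1| := by fun_prop
  rw [lintegral_withDensity_eq_lintegral_mul _ hf.ennreal_ofReal hh,
    ← lintegral_const_mul _ hm, ← lintegral_add_right _ (hm.const_mul _),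
    ← lintegral_add_right _ (hm.const_mul _)]
  constructor <;> refine lintegral_mono_ae ?_ <;> filter_upwards [hC] with x hx
  · calc h x = h x * ENNReal.ofReal 1 := by simp
      _ ≤ h x * ENNReal.ofReal (f x + |f x - 1|) := by
        gcongr
        linarith [neg_abs_le (f x - 1)]
      _ = ENNReal.ofReal (f x) * h x + h x * ENNReal.ofReal |f x - 1| := by
        rw [ENNReal.ofReal_add (hf0 x) (abs_nonneg _)]; ring
      _ ≤ _ := by gcongr; rfl
  · calc ENNReal.ofReal (f x) * h x ≤ ENNReal.ofReal (1 + |f x - 1|) * h x := by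
          gcongr
          linarith [le_abs_self (f x - 1)]
      _ = h x + h x * ENNReal.ofReal |f x - 1| := by
        rw [ENNReal.ofReal_add zero_le_one (abs_nonneg _)]; simp; ring
      _ ≤ _ := by gcongr

lemma exists_boundedContinuous_eq_min {X : Type*} [TopologicalSpace X] {F : X → NNReal}
    (hF : Continuous F) (R : NNReal) :
    ∃ g : BoundedContinuousFunction X NNReal, ∀ x, g x = min (F x) R := by
  refine ⟨BoundedContinuousFunction.mkOfBound ⟨fun x => min (F x) R, by fun_prop⟩ R ?_,
    fun x => rfl⟩
  intro x y
  rw [NNReal.dist_eq, abs_le]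
  have h1 : ((min (F x) R : NNReal) : ℝ) ≤ R := by exact_mod_cast min_le_right _ _
  have h2 : ((min (F y) R : NNReal) : ℝ) ≤ R := by exact_mod_cast min_le_right _ _
  have h3 := (min (F x) R).coe_nonneg
  have h4 := (min (F y) R).coe_nonneg
  simp only [ContinuousMap.coe_mk]
  constructor <;> linarith

lemma ofReal_dist_sq {n : ℕ} (x y : Eucl n) :
    ENNReal.ofReal (dist x y ^ 2) = ((nndist x y ^ 2 : NNReal) : ℝ≥0∞) := by
  rw [← coe_nndist, ← NNReal.coe_pow, ENNReal.ofReal_coe_nnreal]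

lemma enorm_add_sq_le {E : Type*} [SeminormedAddCommGroup E] (a b : E) :
    ‖a + b‖ₑ ^ 2 ≤ 2 * ‖a‖ₑ ^ 2 + 2 * ‖b‖ₑ ^ 2 := by
  have h : ‖a + b‖₊ ^ 2 ≤ 2 * ‖a‖₊ ^ 2 + 2 * ‖b‖₊ ^ 2 := by
    have h1 : ‖a + b‖ ^ 2 ≤ 2 * ‖a‖ ^ 2 + 2 * ‖b‖ ^ 2 := by
      nlinarith [norm_add_le a b, norm_nonneg (a + b), sq_nonneg (‖a‖ - ‖b‖)]
    exact_mod_cast h1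
  simp only [enorm_eq_nnnorm]
  exact_mod_cast h

/-- Stability of optimal transport maps: plans induced by maps which are asymptotically
admissible and asymptotically optimal converge to the unique optimal plan. -/
theorem tendsto_map_graph_of_unique {n : ℕ} {K : Set (Eucl n)} (hK : IsCompact K)
    {μ0 μ1 : Measure (Eucl n)} [IsProbabilityMeasure μ0] [IsProbabilityMeasure μ1]
    (hμ0K : μ0 Kᶜ = 0) (hμ1K : μ1 Kᶜ = 0) {T : Eucl n → Eucl n} (hT : Measurable T)
    (hTuniq : ∀ γ : Measure (Eucl n × Eucl n), γ.map Prod.fst = μ0 → γ.map Prod.snd = μ1 →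
      ∫⁻ p, ENNReal.ofReal (dist p.1 p.2 ^ 2) ∂γ = W2sq μ0 μ1 →
      γ = μ0.map fun x => (x, T x))
    {S : ℕ → Eucl n → Eucl n} (hS : ∀ m, Measurable (S m))
    (hSK : ∀ᶠ m in atTop, ∀ᵐ x ∂μ0, S m x ∈ K)
    (hmarg : ∀ ψ : BoundedContinuousFunction (Eucl n) NNReal,
      Tendsto (fun m => ∫⁻ x, ψ (S m x) ∂μ0) atTop (𝓝 (∫⁻ y, ψ y ∂μ1)))
    {u : ℕ → ℝ≥0∞} (hu : Tendsto u atTop (𝓝 (W2sq μ0 μ1)))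
    (hcost : ∀ᶠ m in atTop, ∫⁻ x, ENNReal.ofReal (dist x (S m x) ^ 2) ∂μ0 ≤ u m)
    (f : BoundedContinuousFunction (Eucl n × Eucl n) NNReal) :
    Tendsto (fun m => ∫⁻ x, f (x, S m x) ∂μ0) atTop (𝓝 (∫⁻ x, f (x, T x) ∂μ0)) := by
  have hgS : ∀ m, Measurable fun x => (x, S m x) := fun m => measurable_id.prodMk (hS m)
  have hgT : Measurable fun x => (x, T x) := measurable_id.prodMk hT
  have hfm : ∀ f : BoundedContinuousFunction (Eucl n × Eucl n) NNReal,
      Measurable fun p => (f p : ℝ≥0∞) := fun f => f.continuous.measurable.coe_nnreal_ennreal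
  let P : ℕ → ProbabilityMeasure (Eucl n × Eucl n) := fun m =>
    ⟨μ0.map fun x => (x, S m x), Measure.isProbabilityMeasure_map (hgS m).aemeasurable⟩
  let Q : ProbabilityMeasure (Eucl n × Eucl n) :=
    ⟨μ0.map fun x => (x, T x), Measure.isProbabilityMeasure_map hgT.aemeasurable⟩
  have hP : ∀ m (f : BoundedContinuousFunction (Eucl n × Eucl n) NNReal),
      ∫⁻ p, f p ∂(P m : Measure (Eucl n × Eucl n)) = ∫⁻ x, f (x, S m x) ∂μ0 := fun m f =>
    lintegral_map (hfm f) (hgS m)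
  suffices h : Tendsto P atTop (𝓝 Q) by
    have h2 := ProbabilityMeasure.tendsto_iff_forall_lintegral_tendsto.1 h f
    simp only [hP] at h2
    rwa [show ∫⁻ p, f p ∂(Q : Measure (Eucl n × Eucl n)) = ∫⁻ x, f (x, T x) ∂μ0 from
      lintegral_map (hfm f) hgT] at h2
  have hKK : MeasurableSet (K ×ˢ K) := hK.measurableSet.prod hK.measurableSet
  let 𝒮 : Set (ProbabilityMeasure (Eucl n × Eucl n)) :=
    {ν | (ν : Measure (Eucl n × Eucl n)) (K ×ˢ K)ᶜ = 0}
  have hcpt : IsCompact (closure 𝒮) := by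
    refine isCompact_closure_of_isTightMeasureSet ?_
    rw [isTightMeasureSet_iff_exists_isCompact_measure_compl_le]
    refine fun ε _ => ⟨K ×ˢ K, hK.prod hK, ?_⟩
    rintro _ ⟨ν, hν, rfl⟩
    exact (le_of_eq hν).trans (zero_le)
  have hK0 : ∀ᵐ x ∂μ0, x ∈ K := hμ0K
  have hK1 : ∀ᵐ x ∂μ1, x ∈ K := hμ1K
  refine hcpt.tendsto_nhds_of_unique_mapClusterPt ?_ ?_
  · filter_upwards [hSK] with m hm
    refine subset_closure ?_
    change (μ0.map fun x => (x, S m x)) (K ×ˢ K)ᶜ = 0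
    rw [Measure.map_apply (hgS m) hKK.compl]
    have : ∀ᵐ x ∂μ0, (x, S m x) ∈ K ×ˢ K := by
      filter_upwards [hm, hK0] with x h1 h2 using ⟨h2, h1⟩
    exact this
  · intro ν _ hν
    obtain ⟨U, hU, hUν⟩ := mapClusterPt_iff_ultrafilter.1 hν
    have hlim := ProbabilityMeasure.tendsto_iff_forall_lintegral_tendsto.1 hUν
    simp only [hP] at hlim
    have hfst : (ν : Measure (Eucl n × Eucl n)).map Prod.fst = μ0 := by
      have := Measure.isProbabilityMeasure_map
        (μ := (ν : Measure (Eucl n × Eucl n))) measurable_fst.aemeasurable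
      refine ext_of_forall_lintegral_eq_of_IsFiniteMeasure fun ψ => ?_
      rw [lintegral_map ψ.continuous.measurable.coe_nnreal_ennreal measurable_fst]
      exact tendsto_nhds_unique (hlim (ψ.compContinuous ⟨Prod.fst, continuous_fst⟩))
        tendsto_const_nhds
    have hsnd : (ν : Measure (Eucl n × Eucl n)).map Prod.snd = μ1 := by
      have := Measure.isProbabilityMeasure_map
        (μ := (ν : Measure (Eucl n × Eucl n))) measurable_snd.aemeasurable
      refine ext_of_forall_lintegral_eq_of_IsFiniteMeasure fun ψ => ?_
      rw [lintegral_map ψ.continuous.measurable.coe_nnreal_ennreal measurable_snd]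
      exact tendsto_nhds_unique (hlim (ψ.compContinuous ⟨Prod.snd, continuous_snd⟩))
        ((hmarg ψ).mono_left hU)
    have hνK : ∀ᵐ p ∂(ν : Measure (Eucl n × Eucl n)), p ∈ K ×ˢ K := by
      have h1 : ∀ᵐ p ∂(ν : Measure (Eucl n × Eucl n)), p.1 ∈ K :=
        ae_of_ae_map measurable_fst.aemeasurable (by rw [hfst]; exact hK0)
      have h2 : ∀ᵐ p ∂(ν : Measure (Eucl n × Eucl n)), p.2 ∈ K :=
        ae_of_ae_map measurable_snd.aemeasurable (by rw [hsnd]; exact hK1)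
      filter_upwards [h1, h2] with p h1 h2 using ⟨h1, h2⟩
    have hopt : ∫⁻ p, ENNReal.ofReal (dist p.1 p.2 ^ 2) ∂(ν : Measure (Eucl n × Eucl n))
        = W2sq μ0 μ1 := by
      refine le_antisymm ?_ (iInf₂_le (ν : Measure (Eucl n × Eucl n)) ⟨hfst, hsnd⟩)
      obtain ⟨R, hR⟩ := (hK.prod hK).bddAbove_image
        (f := fun p : Eucl n × Eucl n => nndist p.1 p.2 ^ 2) (by fun_prop)
      obtain ⟨g, hg⟩ := exists_boundedContinuous_eq_min
        (F := fun p : Eucl n × Eucl n => nndist p.1 p.2 ^ 2) (by fun_prop) R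
      calc ∫⁻ p, ENNReal.ofReal (dist p.1 p.2 ^ 2) ∂(ν : Measure (Eucl n × Eucl n))
          = ∫⁻ p, g p ∂(ν : Measure (Eucl n × Eucl n)) := by
            refine lintegral_congr_ae ?_
            filter_upwards [hνK] with p hp
            rw [ofReal_dist_sq, hg, min_eq_left (hR ⟨p, hp, rfl⟩)]
        _ ≤ W2sq μ0 μ1 := by
            refine le_of_tendsto_of_tendsto (hlim g) (hu.mono_left hU) ?_
            filter_upwards [hU hcost] with m hm
            refine le_trans (lintegral_mono fun x => ?_) hm
            rw [ofReal_dist_sq, hg]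
            exact ENNReal.coe_le_coe.2 (min_le_left _ _)
    exact Subtype.ext (hTuniq _ hfst hsnd hopt)

theorem tendsto_lintegral_enorm_sub_of_tendsto_map_graph {n : ℕ} {K : Set (Eucl n)}
    (hK : IsCompact K) {μ : Measure (Eucl n)} [IsProbabilityMeasure μ]
    {T : Eucl n → Eucl n} (hT : Measurable T) (hTK : ∀ᵐ x ∂μ, T x ∈ K)
    {S : ℕ → Eucl n → Eucl n} (hS : ∀ m, Measurable (S m))
    (hSK : ∀ᶠ m in atTop, ∀ᵐ x ∂μ, S m x ∈ K)
    (h : ∀ f : BoundedContinuousFunction (Eucl n × Eucl n) NNReal,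
      Tendsto (fun m => ∫⁻ x, f (x, S m x) ∂μ) atTop (𝓝 (∫⁻ x, f (x, T x) ∂μ))) :
    Tendsto (fun m => ∫⁻ x, ‖S m x - T x‖ₑ ^ 2 ∂μ) atTop (𝓝 0) := by
  obtain ⟨C, hC⟩ := hK.isBounded.exists_norm_le
  have hmem : MemLp T 2 μ := MemLp.of_bound hT.aestronglyMeasurable C (hTK.mono fun x hx => hC _ hx)
  rw [ENNReal.tendsto_nhds_zero]
  intro ε hε
  have hδ : min (ε / 7) 1 ≠ 0 := by
    simp [hε.ne']
  set δ := min (ε / 7) 1 with hδdef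
  have hδε : 7 * δ ≤ ε := by
    calc 7 * δ ≤ 7 * (ε / 7) := by gcongr; exact min_le_left _ _
      _ = ε := ENNReal.mul_div_cancel (by norm_num) (by norm_num)
  obtain ⟨g, hg, _⟩ := hmem.exists_boundedContinuous_eLpNorm_sub_le (by norm_num) hδ
  have hgT : ∫⁻ x, ‖T x - g x‖ₑ ^ 2 ∂μ ≤ δ := by
    have h1 := eLpNorm_nnreal_pow_eq_lintegral (μ := μ) (f := T - ⇑g) (p := 2) (by norm_num)
    simp only [NNReal.coe_ofNat, ENNReal.coe_ofNat, ENNReal.rpow_ofNat] at h1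
    calc ∫⁻ x, ‖T x - g x‖ₑ ^ 2 ∂μ = eLpNorm (T - ⇑g) 2 μ ^ 2 := h1.symm
      _ ≤ δ ^ 2 := by gcongr
      _ ≤ δ * 1 := by rw [sq]; gcongr; exact min_le_right _ _
      _ = δ := mul_one δ
  obtain ⟨f, hf⟩ := exists_boundedContinuous_eq_min
    (F := fun p : Eucl n × Eucl n => ‖p.2 - g p.1‖₊ ^ 2)
    (by fun_prop) ((C.toNNReal + ‖g‖₊) ^ 2)
  have hfS : ∀ y ∈ K, ∀ x, (f (x, y) : ℝ≥0∞) = ‖y - g x‖ₑ ^ 2 := by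
    intro y hy x
    rw [hf, min_eq_left, enorm_eq_nnnorm]
    · push_cast; rfl
    · gcongr
      refine (nnnorm_sub_le _ _).trans (add_le_add ?_ (g.nnnorm_coe_le_nnnorm x))
      rw [← norm_toNNReal]
      exact Real.toNNReal_le_toNNReal (hC y hy)
  have hfT : ∫⁻ x, f (x, T x) ∂μ ≤ δ := by
    refine le_trans (le_of_eq (lintegral_congr_ae ?_)) hgT
    filter_upwards [hTK] with x hx using hfS _ hx x
  have hlt : ∫⁻ x, f (x, T x) ∂μ < 2 * δ := by
    have hδtop : δ ≠ ⊤ := ne_top_of_le_ne_top ENNReal.one_ne_top (min_le_right _ _)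
    refine hfT.trans_lt ?_
    rw [two_mul]
    exact ENNReal.lt_add_right hδtop hδ
  filter_upwards [(h f).eventually_lt_const hlt, hSK] with m hm hmK
  have hgm : Measurable g := g.continuous.measurable
  have hSm := hS m
  calc ∫⁻ x, ‖S m x - T x‖ₑ ^ 2 ∂μ
      ≤ ∫⁻ x, (2 * ‖S m x - g x‖ₑ ^ 2 + 2 * ‖T x - g x‖ₑ ^ 2) ∂μ := by
        refine lintegral_mono fun x => ?_
        have := enorm_add_sq_le (S m x - g x) (g x - T x)
        rwa [sub_add_sub_cancel, ← neg_sub (T x) (g x), enorm_neg] at this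
    _ = 2 * ∫⁻ x, f (x, S m x) ∂μ + 2 * ∫⁻ x, ‖T x - g x‖ₑ ^ 2 ∂μ := by
        rw [lintegral_add_left (by fun_prop), lintegral_const_mul _ (by fun_prop),
          lintegral_const_mul _ (by fun_prop)]
        congr 2
        refine lintegral_congr_ae ?_
        filter_upwards [hmK] with x hx using (hfS _ hx x).symm
    _ ≤ 2 * (2 * δ) + 2 * δ := by gcongr
    _ = 6 * δ := by ring
    _ ≤ 7 * δ := by gcongr; norm_num
    _ ≤ ε := hδε

/-- A priori estimates on the marginals of a minimizer for large `κ`. -/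
theorem bounds_of_isMin {n : ℕ} {K : Set (Eucl n)} {D : ℝ}
    (hD : ∀ x ∈ K, ∀ y ∈ K, dist x y ≤ D)
    {μ0 μ1 : Measure (Eucl n)} [IsProbabilityMeasure μ0] [IsProbabilityMeasure μ1]
    (hμ0K : ∀ᵐ x ∂μ0, x ∈ K) (hμ1K : ∀ᵐ x ∂μ1, x ∈ K)
    {κ : ℝ} (hκ : 2 * D ^ 2 + 1 ≤ κ) (hDκ : D / κ < Real.pi / 2)
    (hcos : 1 / 2 ≤ Real.cos (D / κ))
    {γ : Measure (Eucl n × Eucl n)} (hγ0 : γ.map Prod.fst = μ0) (hγ1 : γ.map Prod.snd = μ1)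
    {π : Measure (Eucl n × Eucl n)} [IsFiniteMeasure π]
    (hmin : ∀ π' : Measure (Eucl n × Eucl n), IsFiniteMeasure π' →
      HKfun κ π μ0 μ1 ≤ HKfun κ π' μ0 μ1) :
    π.map Prod.fst ≪ μ0 ∧ π.map Prod.snd ≪ μ1 ∧
    (∀ᵐ x ∂μ0, Real.exp (-5) ≤ ((π.map Prod.fst).rnDeriv μ0 x).toReal) ∧
    (∀ᵐ x ∂μ1, Real.exp (-5) ≤ ((π.map Prod.snd).rnDeriv μ1 x).toReal) ∧
    (∀ᵐ x ∂μ0, ((π.map Prod.fst).rnDeriv μ0 x).toReal ≤ 2 * Real.exp 7) ∧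
    (∫⁻ x, ENNReal.ofReal |((π.map Prod.fst).rnDeriv μ0 x).toReal - 1| ∂μ0
      ≤ ENNReal.ofReal ((2 * D ^ 2 + 1) / κ)) ∧
    (∫⁻ x, ENNReal.ofReal |((π.map Prod.snd).rnDeriv μ1 x).toReal - 1| ∂μ1
      ≤ ENNReal.ofReal ((2 * D ^ 2 + 1) / κ)) ∧
    ∫⁻ p, cHK κ p.1 p.2 ∂π ≤ ENNReal.ofReal (Real.cos (D / κ))⁻¹ *
      ∫⁻ p, ENNReal.ofReal (dist p.1 p.2 ^ 2) ∂γ := by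
  have hκ1 : 1 ≤ κ := by nlinarith [sq_nonneg D]
  have hκ0 : 0 < κ := by linarith
  have hcinv : (Real.cos (D / κ))⁻¹ ≤ 2 := by
    rw [inv_le_comm₀ (by linarith) (by norm_num)]; linarith
  have hγp : IsProbabilityMeasure γ := by
    constructor
    have : γ.map Prod.fst Set.univ = 1 := by rw [hγ0]; exact measure_univ
    rwa [Measure.map_apply measurable_fst MeasurableSet.univ, Set.preimage_univ] at this
  have hc : ∀ p : Eucl n × Eucl n, p.1 ∈ K → p.2 ∈ K → cHK κ p.1 p.2
      ≤ ENNReal.ofReal (Real.cos (D / κ))⁻¹ * ENNReal.ofReal (dist p.1 p.2 ^ 2) :=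
    fun p h1 h2 => cHK_le hκ0 (hD _ h1 _ h2) hDκ
  have hcD : ∀ p : Eucl n × Eucl n, p.1 ∈ K → p.2 ∈ K → ENNReal.ofReal (Real.cos (D / κ))⁻¹ *
      ENNReal.ofReal (dist p.1 p.2 ^ 2) ≤ ENNReal.ofReal (2 * D ^ 2) := by
    intro p h1 h2
    have := hD _ h1 _ h2
    rw [ENNReal.ofReal_mul (by norm_num)]
    gcongr
  have hprod : ∀ (ν0 ν1 : Measure (Eucl n)) [IsProbabilityMeasure ν0] [IsProbabilityMeasure ν1],
      (∀ᵐ x ∂ν0, x ∈ K) → (∀ᵐ x ∂ν1, x ∈ K) →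
      ∀ᵐ p ∂(ν0.prod ν1), cHK κ p.1 p.2 ≤ ENNReal.ofReal (κ ^ 2) := by
    intro ν0 ν1 _ _ h0 h1
    have h0' := Measure.quasiMeasurePreserving_fst (μ := ν0) (ν := ν1) |>.ae h0
    have h1' := Measure.quasiMeasurePreserving_snd (μ := ν0) (ν := ν1) |>.ae h1
    filter_upwards [h0', h1'] with p h0 h1
    refine (hc p h0 h1).trans ((hcD p h0 h1).trans (ENNReal.ofReal_le_ofReal ?_))
    nlinarith
  have hγK : ∀ᵐ p ∂γ, p.1 ∈ K ∧ p.2 ∈ K := by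
    have h1 : ∀ᵐ p ∂γ, p.1 ∈ K := ae_of_ae_map measurable_fst.aemeasurable (by rwa [hγ0])
    have h2 : ∀ᵐ p ∂γ, p.2 ∈ K := ae_of_ae_map measurable_snd.aemeasurable (by rwa [hγ1])
    exact h1.and h2
  have hE1 : HKfun κ π μ0 μ1 ≤ ENNReal.ofReal (Real.cos (D / κ))⁻¹ *
      ∫⁻ p, ENNReal.ofReal (dist p.1 p.2 ^ 2) ∂γ := by
    refine (hmin γ inferInstance).trans ?_
    rw [HKfun, hγ0, hγ1, KLdiv_self, KLdiv_self, mul_zero, add_zero, add_zero,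
      ← lintegral_const_mul _ (by fun_prop)]
    refine lintegral_mono_ae ?_
    filter_upwards [hγK] with p hp using hc p hp.1 hp.2
  have hE2 : HKfun κ π μ0 μ1 ≤ ENNReal.ofReal (2 * D ^ 2) := by
    refine hE1.trans ?_
    rw [← lintegral_const_mul _ (by fun_prop)]
    refine (lintegral_mono_ae (hγK.mono fun p hp => hcD p hp.1 hp.2)).trans ?_
    rw [lintegral_const, measure_univ, mul_one]
  have hfin : HKfun κ π μ0 μ1 ≠ ⊤ := ne_top_of_le_ne_top ENNReal.ofReal_ne_top hE2
  have hκ2 : 0 < κ ^ 2 := by positivity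
  have hdiv : ∀ L : ℝ≥0∞, ENNReal.ofReal (κ ^ 2) * L ≤ ENNReal.ofReal (2 * D ^ 2) →
      L ≤ ENNReal.ofReal (2 * D ^ 2 / κ ^ 2) := by
    intro L hL
    rw [ENNReal.ofReal_div_of_pos hκ2, ENNReal.le_div_iff_mul_le
      (Or.inl (by simpa using hκ0.ne')) (Or.inl ENNReal.ofReal_ne_top), mul_comm]
    exact hL
  have hL0 : KLdiv (π.map Prod.fst) μ0 ≤ ENNReal.ofReal (2 * D ^ 2 / κ ^ 2) :=
    hdiv _ ((le_add_self.trans le_self_add).trans hE2)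
  have hL1 : KLdiv (π.map Prod.snd) μ1 ≤ ENNReal.ofReal (2 * D ^ 2 / κ ^ 2) :=
    hdiv _ (le_add_self.trans hE2)
  have hac0 := KLdiv_ne_top_ac (ne_top_of_le_ne_top ENNReal.ofReal_ne_top hL0)
  have hac1 := KLdiv_ne_top_ac (ne_top_of_le_ne_top ENNReal.ofReal_ne_top hL1)
  have hpin : ∀ (ρ μ : Measure (Eucl n)) [IsProbabilityMeasure μ], ρ ≪ μ →
      KLdiv ρ μ ≤ ENNReal.ofReal (2 * D ^ 2 / κ ^ 2) →
      ∫⁻ x, ENNReal.ofReal |(ρ.rnDeriv μ x).toReal - 1| ∂μ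
        ≤ ENNReal.ofReal ((2 * D ^ 2 + 1) / κ) := by
    intro ρ μ _ hac hL
    refine (lintegral_abs_sub_one_le (f := fun x => (ρ.rnDeriv μ x).toReal) (l := κ⁻¹)
      (Measure.measurable_rnDeriv _ _).ennreal_toReal (fun x => ENNReal.toReal_nonneg)
      (by positivity) (inv_le_one_of_one_le₀ hκ1)).trans ?_
    rw [← KLdiv_of_ac hac]
    calc _ ≤ ENNReal.ofReal (2 * D ^ 2 / κ ^ 2) / ENNReal.ofReal κ⁻¹ + ENNReal.ofReal κ⁻¹ := by
          gcongr
      _ = _ := by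
          rw [← ENNReal.ofReal_div_of_pos (by positivity),
            ← ENNReal.ofReal_add (by positivity) (by positivity)]
          congr 1
          field_simp
  have hP0 := hpin _ _ hac0 hL0
  have hP1 := hpin _ _ hac1 hL1
  have hmass : π Set.univ ≤ 2 := by
    have h1 := (lintegral_le_lintegral_withDensity_add (μ := μ0)
      (f := fun x => ((π.map Prod.fst).rnDeriv μ0 x).toReal) (h := fun _ => 1) (C := 1)
      (Measure.measurable_rnDeriv _ _).ennreal_toReal (fun x => ENNReal.toReal_nonneg)
      measurable_const (Eventually.of_forall fun _ => le_rfl)).2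
    rw [withDensity_ofReal_rnDeriv hac0, lintegral_one, lintegral_one, one_mul,
      measure_univ (μ := μ0),
      Measure.map_apply measurable_fst MeasurableSet.univ, Set.preimage_univ] at h1
    refine h1.trans ((add_le_add le_rfl hP0).trans ?_)
    have : ENNReal.ofReal ((2 * D ^ 2 + 1) / κ) ≤ 1 := by
      rw [ENNReal.ofReal_le_one, div_le_one hκ0]; exact hκ
    calc _ ≤ (1 : ℝ≥0∞) + 1 := by gcongr
      _ = 2 := by norm_num
  have hlow0 := exp_le_rnDeriv_of_isMin hκ0 hmin hac0 hac1 hfin hmass (hprod _ _ hμ0K hμ1K)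
  have hlow1 : ∀ᵐ x ∂μ1, Real.exp (-5) ≤ ((π.map Prod.snd).rnDeriv μ1 x).toReal := by
    have h1 : (π.map Prod.swap).map Prod.fst = π.map Prod.snd :=
      Measure.map_map measurable_fst measurable_swap
    have h2 : (π.map Prod.swap).map Prod.snd = π.map Prod.fst :=
      Measure.map_map measurable_snd measurable_swap
    rw [← h1]
    refine exp_le_rnDeriv_of_isMin (μ1 := μ0) hκ0 (fun π' hπ' => ?_) (by rwa [h1]) (by rwa [h2])
      (by rwa [HKfun_swap]) ?_ (hprod _ _ hμ1K hμ0K)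
    · rw [HKfun_swap, ← HKfun_swap κ π' μ1 μ0]
      exact hmin _ inferInstance
    · rwa [Measure.map_apply measurable_swap MeasurableSet.univ, Set.preimage_univ]
  exact ⟨hac0, hac1, hlow0, hlow1, rnDeriv_le_exp_of_isMin hκ0 hmin hac0 hac1 hfin hlow1, hP0, hP1,
    (le_self_add.trans le_self_add).trans hE1⟩

lemma norm_velocity_sub_sq_le {n : ℕ} {κ D s M : ℝ} (hκ : 0 < κ) (hD : D / κ < Real.pi / 2)
    (hs : 0 ≤ s) (hsM : s ≤ M) (hM : 1 ≤ M) {x y : Eucl n} (hd : ‖y - x‖ ≤ D) :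
    ‖(κ * s * Real.tan (‖y - x‖ / κ) / ‖y - x‖) • (y - x) - (y - x)‖ ^ 2
      ≤ 2 * D ^ 2 * (M * |s - 1| + (M * ((Real.cos (D / κ))⁻¹ - 1)) ^ 2) := by
  rcases (norm_nonneg (y - x)).eq_or_lt with h0 | h0
  · rw [eq_comm, norm_eq_zero] at h0
    have hM0 : 0 ≤ M := by linarith
    rw [h0, smul_zero, sub_zero, norm_zero, zero_pow two_ne_zero]
    positivity
  · set d := ‖y - x‖ with hddef
    have hG := abs_tan_div_sub_one_le (s := d / κ) (a := D / κ) (by positivity) (by gcongr) hD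
    set G := Real.tan (d / κ) / (d / κ) with hGdef
    set q := (Real.cos (D / κ))⁻¹ - 1 with hq
    have hcoef : κ * s * Real.tan (d / κ) / d = s * G := by rw [hGdef]; field_simp
    have h1 : (s * G) • (y - x) - (y - x) = (s * G - 1) • (y - x) := by rw [sub_smul, one_smul]
    rw [hcoef, h1, norm_smul, mul_pow, Real.norm_eq_abs, ← hddef]
    have h2 : |s * G - 1| ≤ |s - 1| + M * q := by
      have : s * G - 1 = (s - 1) + s * (G - 1) := by ring
      rw [this]
      refine (abs_add_le _ _).trans ?_
      rw [abs_mul, abs_of_nonneg hs]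
      gcongr
    have h3 : |s - 1| ≤ M := by
      rw [abs_le]; constructor <;> linarith
    have h4 : |s * G - 1| ^ 2 ≤ 2 * (M * |s - 1| + (M * q) ^ 2) := by
      have h5 : |s * G - 1| ^ 2 ≤ (|s - 1| + M * q) ^ 2 := by gcongr
      nlinarith [sq_nonneg (|s - 1| - M * q), abs_nonneg (s - 1)]
    calc |s * G - 1| ^ 2 * d ^ 2 ≤ 2 * (M * |s - 1| + (M * q) ^ 2) * D ^ 2 := by gcongr
      _ = _ := by ring

lemma ENNReal.tendsto_of_le_add_of_le_add {a r : ℕ → ℝ≥0∞} {I : ℝ≥0∞}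
    (hr : Tendsto r atTop (𝓝 0)) (h1 : ∀ᶠ m in atTop, a m ≤ I + r m)
    (h2 : ∀ᶠ m in atTop, I ≤ a m + r m) : Tendsto a atTop (𝓝 I) := by
  refine tendsto_of_tendsto_of_tendsto_of_le_of_le' (g := fun m => I - r m)
    (h := fun m => I + r m) ?_ ?_ ?_ h1
  · simpa using ENNReal.Tendsto.sub (tendsto_const_nhds (x := I)) hr (Or.inr ENNReal.zero_ne_top)
  · simpa using (tendsto_const_nhds (x := I)).add hr
  · filter_upwards [h2] with m hm using tsub_le_iff_right.2 hm


lemma ae_graph_mem {n : ℕ} {K : Set (Eucl n)} {μ0 μ1 : Measure (Eucl n)}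
    (hμ1K : ∀ᵐ x ∂μ1, x ∈ K) {π : Measure (Eucl n × Eucl n)} {S : Eucl n → Eucl n}
    (hS : Measurable S) (hπ : π.map Prod.snd = (π.map Prod.fst).map S)
    (hac0 : μ0 ≪ π.map Prod.fst) (hac1 : π.map Prod.snd ≪ μ1) : ∀ᵐ x ∂μ0, S x ∈ K := by
  have h1 := hac1.ae_le hμ1K
  rw [hπ] at h1
  exact hac0.ae_le (ae_of_ae_map hS.aemeasurable h1)

lemma lintegral_graph_bounds {n : ℕ} {μ0 μ1 : Measure (Eucl n)}
    [IsProbabilityMeasure μ0] [IsProbabilityMeasure μ1]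
    {π : Measure (Eucl n × Eucl n)} [IsFiniteMeasure π] {S : Eucl n → Eucl n}
    (hS : Measurable S) (hπ : π.map Prod.snd = (π.map Prod.fst).map S)
    (hac0 : π.map Prod.fst ≪ μ0) (hac1 : π.map Prod.snd ≪ μ1) {e : ℝ≥0∞}
    (he0 : ∫⁻ x, ENNReal.ofReal |((π.map Prod.fst).rnDeriv μ0 x).toReal - 1| ∂μ0 ≤ e)
    (he1 : ∫⁻ x, ENNReal.ofReal |((π.map Prod.snd).rnDeriv μ1 x).toReal - 1| ∂μ1 ≤ e)
    {h : Eucl n → ℝ≥0∞} (hh : Measurable h) {C : ℝ≥0∞} (hC : ∀ x, h x ≤ C) :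
    ∫⁻ x, h (S x) ∂μ0 ≤ ∫⁻ x, h x ∂μ1 + (C * e + C * e) ∧
    ∫⁻ x, h x ∂μ1 ≤ ∫⁻ x, h (S x) ∂μ0 + (C * e + C * e) := by
  have h0 := lintegral_le_lintegral_withDensity_add (μ := μ0)
    (f := fun x => ((π.map Prod.fst).rnDeriv μ0 x).toReal) (h := fun x => h (S x)) (C := C)
    (Measure.measurable_rnDeriv _ _).ennreal_toReal (fun x => ENNReal.toReal_nonneg)
    (hh.comp hS) (Eventually.of_forall fun x => hC _)
  have h1 := lintegral_le_lintegral_withDensity_add (μ := μ1)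
    (f := fun x => ((π.map Prod.snd).rnDeriv μ1 x).toReal) (h := h) (C := C)
    (Measure.measurable_rnDeriv _ _).ennreal_toReal (fun x => ENNReal.toReal_nonneg)
    hh (Eventually.of_forall hC)
  rw [withDensity_ofReal_rnDeriv hac0] at h0
  rw [withDensity_ofReal_rnDeriv hac1, hπ, lintegral_map hh hS, ← hπ] at h1
  have hC0 : C * _ ≤ C * e := mul_le_mul_right he0 C
  have hC1 : C * _ ≤ C * e := mul_le_mul_right he1 C
  constructor
  · refine (h0.1.trans (add_le_add h1.2 hC0)).trans ?_
    rw [add_assoc]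
    gcongr
  · refine (h1.1.trans (add_le_add h0.2 hC1)).trans ?_
    rw [add_assoc]
    gcongr

lemma lintegral_sq_dist_graph_le {n : ℕ} {K : Set (Eucl n)} {D : ℝ}
    (hD : ∀ x ∈ K, ∀ y ∈ K, dist x y ≤ D) {μ0 : Measure (Eucl n)} [IsProbabilityMeasure μ0]
    (hμ0K : ∀ᵐ x ∂μ0, x ∈ K) {κ : ℝ} (hκ : 0 < κ)
    {π : Measure (Eucl n × Eucl n)} [IsFiniteMeasure π] {S : Eucl n → Eucl n}
    (hS : Measurable S) (hπ : π = (π.map Prod.fst).map fun x => (x, S x))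
    (hac : π.map Prod.fst ≪ μ0) (hSK : ∀ᵐ x ∂μ0, S x ∈ K) {e c : ℝ≥0∞}
    (he : ∫⁻ x, ENNReal.ofReal |((π.map Prod.fst).rnDeriv μ0 x).toReal - 1| ∂μ0 ≤ e)
    (hc : ∫⁻ p, cHK κ p.1 p.2 ∂π ≤ c) :
    ∫⁻ x, ENNReal.ofReal (dist x (S x) ^ 2) ∂μ0
      ≤ ENNReal.ofReal (1 + (D / κ) ^ 2) * c + ENNReal.ofReal (D ^ 2) * e := by
  have hg : Measurable fun x => (x, S x) := measurable_id.prodMk hS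
  have hdist : ∀ᵐ x ∂μ0, dist x (S x) ≤ D := by
    filter_upwards [hμ0K, hSK] with x h1 h2 using hD _ h1 _ h2
  have h0 := (lintegral_le_lintegral_withDensity_add (μ := μ0)
    (f := fun x => ((π.map Prod.fst).rnDeriv μ0 x).toReal)
    (h := fun x => ENNReal.ofReal (dist x (S x) ^ 2)) (C := ENNReal.ofReal (D ^ 2))
    (Measure.measurable_rnDeriv _ _).ennreal_toReal (fun x => ENNReal.toReal_nonneg)
    (by fun_prop) (hdist.mono fun x hx => ENNReal.ofReal_le_ofReal (by gcongr))).1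
  rw [withDensity_ofReal_rnDeriv hac] at h0
  refine h0.trans (add_le_add ?_ (mul_le_mul_right he _))
  have h2 : ∫⁻ p, cHK κ p.1 p.2 ∂π = ∫⁻ x, cHK κ x (S x) ∂(π.map Prod.fst) := by
    conv_lhs => rw [hπ]
    exact lintegral_map (measurable_cHK κ) hg
  have hdistρ : ∀ᵐ x ∂(π.map Prod.fst), dist x (S x) ≤ D := hac.ae_le hdist
  have h3 : ∫⁻ x, ENNReal.ofReal (dist x (S x) ^ 2) ∂(π.map Prod.fst) ≤
      ∫⁻ x, ENNReal.ofReal (1 + (D / κ) ^ 2) * cHK κ x (S x) ∂(π.map Prod.fst) :=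
    lintegral_mono_ae (hdistρ.mono fun x hx => sq_dist_le_cHK hκ hx)
  rw [lintegral_const_mul' _ _ ENNReal.ofReal_ne_top, ← h2] at h3
  exact h3.trans (mul_le_mul_right hc _)

lemma ofReal_norm_sq {E : Type*} [SeminormedAddCommGroup E] (a : E) :
    ENNReal.ofReal (‖a‖ ^ 2) = ‖a‖ₑ ^ 2 := by
  rw [ENNReal.ofReal_pow (norm_nonneg _), ofReal_norm]

lemma lintegral_growth_sq_le {α : Type*} [MeasurableSpace α] {μ : Measure α} {s a : α → ℝ}
    {M : ℝ} (hs : ∀ x, 0 ≤ s x) (hM : 1 ≤ M) (hsM : ∀ᵐ x ∂μ, s x ≤ M)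
    (ha : ∀ᵐ x ∂μ, a x = 2 * (s x - 1)) {e : ℝ≥0∞}
    (he : ∫⁻ x, ENNReal.ofReal |s x - 1| ∂μ ≤ e) :
    ∫⁻ x, ENNReal.ofReal (a x ^ 2) ∂μ ≤ ENNReal.ofReal (4 * M) * e := by
  calc _ ≤ ∫⁻ x, ENNReal.ofReal (4 * M) * ENNReal.ofReal |s x - 1| ∂μ := by
        refine lintegral_mono_ae ?_
        filter_upwards [hsM, ha] with x h1 h2
        rw [← ENNReal.ofReal_mul (by linarith), h2]
        refine ENNReal.ofReal_le_ofReal ?_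
        have h3 : |s x - 1| ≤ M := by rw [abs_le]; constructor <;> linarith [hs x]
        nlinarith [abs_nonneg (s x - 1), sq_abs (s x - 1)]
    _ = ENNReal.ofReal (4 * M) * ∫⁻ x, ENNReal.ofReal |s x - 1| ∂μ :=
        lintegral_const_mul' _ _ ENNReal.ofReal_ne_top
    _ ≤ _ := by gcongr

lemma lintegral_velocity_sub_sq_le {n : ℕ} {μ : Measure (Eucl n)} [IsProbabilityMeasure μ]
    {κ D M : ℝ} (hκ : 0 < κ) (hD : D / κ < Real.pi / 2) {s : Eucl n → ℝ} (hsm : Measurable s)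
    (hs : ∀ x, 0 ≤ s x) (hM : 1 ≤ M) (hsM : ∀ᵐ x ∂μ, s x ≤ M) {S T v : Eucl n → Eucl n}
    (hSm : Measurable S) (hTm : Measurable T) (hSD : ∀ᵐ x ∂μ, dist x (S x) ≤ D)
    (hv : ∀ᵐ x ∂μ, v x =
      (κ * s x * Real.tan (‖S x - x‖ / κ) / ‖S x - x‖) • (S x - x)) {e : ℝ≥0∞}
    (he : ∫⁻ x, ENNReal.ofReal |s x - 1| ∂μ ≤ e) :
    ∫⁻ x, ENNReal.ofReal (‖v x - (T x - x)‖ ^ 2) ∂μ ≤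
      2 * (ENNReal.ofReal (2 * D ^ 2) * (ENNReal.ofReal M * e
        + ENNReal.ofReal ((M * ((Real.cos (D / κ))⁻¹ - 1)) ^ 2)))
      + 2 * ∫⁻ x, ‖S x - T x‖ₑ ^ 2 ∂μ := by
  have hM0 : 0 ≤ M := by linarith
  set q := (M * ((Real.cos (D / κ))⁻¹ - 1)) ^ 2 with hq
  have hq0 : 0 ≤ q := sq_nonneg _
  have hmeas : Measurable fun x => ENNReal.ofReal |s x - 1| := by fun_prop
  calc _ ≤ ∫⁻ x, (2 * (ENNReal.ofReal (2 * D ^ 2) * (ENNReal.ofReal M * ENNReal.ofReal |s x - 1|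
        + ENNReal.ofReal q)) + 2 * ‖S x - T x‖ₑ ^ 2) ∂μ := by
        refine lintegral_mono_ae ?_
        filter_upwards [hsM, hSD, hv] with x h1 h2 h3
        have h4 : v x - (T x - x) = (v x - (S x - x)) + (S x - T x) := by abel
        rw [ofReal_norm_sq, h4]
        refine (enorm_add_sq_le _ _).trans ?_
        gcongr
        rw [← ofReal_norm_sq, ← ENNReal.ofReal_mul hM0, ← ENNReal.ofReal_add (by positivity) hq0,
          ← ENNReal.ofReal_mul (by positivity), h3]
        rw [dist_comm, dist_eq_norm] at h2
        exact ENNReal.ofReal_le_ofReal (norm_velocity_sub_sq_le hκ hD (hs x) h1 hM h2)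
    _ = 2 * (ENNReal.ofReal (2 * D ^ 2) * (ENNReal.ofReal M * ∫⁻ x, ENNReal.ofReal |s x - 1| ∂μ
        + ENNReal.ofReal q)) + 2 * ∫⁻ x, ‖S x - T x‖ₑ ^ 2 ∂μ := by
        rw [lintegral_add_left (by fun_prop), lintegral_const_mul _ (by fun_prop),
          lintegral_const_mul _ (by fun_prop), lintegral_add_left (by fun_prop),
          lintegral_const_mul _ (by fun_prop), lintegral_const_mul _ (by fun_prop),
          lintegral_const, measure_univ, mul_one]
    _ ≤ _ := by gcongr

lemma ac_of_pos_le_rnDeriv {α : Type*} [MeasurableSpace α] {ρ μ : Measure α} [IsFiniteMeasure ρ]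
    [SigmaFinite μ] {c : ℝ} (hc : 0 < c) (hac : ρ ≪ μ)
    (h : ∀ᵐ x ∂μ, c ≤ (ρ.rnDeriv μ x).toReal) : μ ≪ ρ := by
  conv_rhs => rw [← Measure.withDensity_rnDeriv_eq ρ μ hac]
  refine withDensity_absolutelyContinuous' (Measure.measurable_rnDeriv _ _).aemeasurable ?_
  filter_upwards [h] with x hx h0
  rw [h0, ENNReal.toReal_zero] at hx
  exact absurd hx (not_le.2 hc)


/-- convergence of the HK logarithmic map to the `W2` logarithmic map
as `κ → ∞`. -/
theorem hk_log_to_w2_log_as_kappa_to_infty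
    {n : ℕ} (hn : 1 ≤ n) (K : Set (Eucl n)) (hK : IsCompact K)
    (μ0 μ1 : Measure (Eucl n)) [IsProbabilityMeasure μ0] [IsProbabilityMeasure μ1]
    (hμ0K : μ0 Kᶜ = 0) (hμ1K : μ1 Kᶜ = 0)
    (hμ0ac : μ0 ≪ (volume : Measure (Eucl n)))
    (κ : ℕ → ℝ) (hκpos : ∀ m, 0 < κ m) (hκtop : Tendsto κ atTop atTop)
    -- for each `m`, `π m = (id, Tm m)_# (π m)₀` is the unique minimizer of `E_{κ m}(·|μ0,μ1)`
    (π : ℕ → Measure (Eucl n × Eucl n)) [∀ m, IsFiniteMeasure (π m)]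
    (hπopt : ∀ m, HKfun (κ m) (π m) μ0 μ1 = HK2 (κ m) μ0 μ1)
    (hπuniq : ∀ m, ∀ π' : Measure (Eucl n × Eucl n), IsFiniteMeasure π' →
      HKfun (κ m) π' μ0 μ1 = HK2 (κ m) μ0 μ1 → π' = π m)
    (Tm : ℕ → Eucl n → Eucl n) (hTm : ∀ m, Measurable (Tm m))
    (hπT : ∀ m, π m = ((π m).map Prod.fst).map (fun x => (x, Tm m x)))
    -- the HK logarithmic components for parameter `κ m`
    (v0m : ℕ → Eucl n → Eucl n) (α0m : ℕ → Eucl n → ℝ)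
    (hv0m : ∀ m, ∀ᵐ x ∂((π m).map Prod.fst), v0m m x =
      (κ m * (((π m).map Prod.fst).rnDeriv μ0 x).toReal
        * Real.tan (‖Tm m x - x‖ / κ m) / ‖Tm m x - x‖) • (Tm m x - x))
    (hv0mperp : ∀ m, ∀ᵐ x ∂(μ0.singularPart ((π m).map Prod.fst)), v0m m x = 0)
    (hα0m : ∀ m, ∀ᵐ x ∂((π m).map Prod.fst),
      α0m m x = 2 * ((((π m).map Prod.fst).rnDeriv μ0 x).toReal - 1))
    (hα0mperp : ∀ m, ∀ᵐ x ∂(μ0.singularPart ((π m).map Prod.fst)), α0m m x = -2)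
    -- `T` is the unique optimal transport map for `W2²(μ0,μ1)`
    (T : Eucl n → Eucl n) (hT : Measurable T)
    (hTmarg : (μ0.map fun x => (x, T x)).map Prod.snd = μ1)
    (hTopt : ∫⁻ p, ENNReal.ofReal (dist p.1 p.2 ^ 2) ∂(μ0.map fun x => (x, T x))
      = W2sq μ0 μ1)
    (hTuniq : ∀ γ : Measure (Eucl n × Eucl n), γ.map Prod.fst = μ0 → γ.map Prod.snd = μ1 →
      ∫⁻ p, ENNReal.ofReal (dist p.1 p.2 ^ 2) ∂γ = W2sq μ0 μ1 →
      γ = μ0.map fun x => (x, T x)) :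
    (∃ M : ℕ, ∀ m ≥ M, μ1.singularPart ((π m).map Prod.snd) = 0) ∧
    Tendsto (fun m => ∫⁻ x, ENNReal.ofReal (‖v0m m x - (T x - x)‖ ^ 2) ∂μ0) atTop (𝓝 0) ∧
    Tendsto (fun m => ∫⁻ x, ENNReal.ofReal (α0m m x ^ 2) ∂μ0) atTop (𝓝 0) := by
  set D := Metric.diam K with hDdef
  have hD : ∀ x ∈ K, ∀ y ∈ K, dist x y ≤ D := fun x hx y hy =>
    Metric.dist_le_diam_of_mem hK.isBounded hx hy
  have hae0 : ∀ᵐ x ∂μ0, x ∈ K := hμ0K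
  have hae1 : ∀ᵐ x ∂μ1, x ∈ K := hμ1K
  have hgT : Measurable fun x => (x, T x) := measurable_id.prodMk hT
  have hTfst : (μ0.map fun x => (x, T x)).map Prod.fst = μ0 := by
    rw [Measure.map_map measurable_fst hgT]
    exact Measure.map_id
  have hTmap : μ0.map T = μ1 := by
    rw [← hTmarg, Measure.map_map measurable_snd hgT]
    rfl
  have hTK : ∀ᵐ x ∂μ0, T x ∈ K := ae_of_ae_map hT.aemeasurable (by rwa [hTmap])
  have hsnd : ∀ m, (π m).map Prod.snd = ((π m).map Prod.fst).map (Tm m) := by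
    intro m
    have hg : Measurable fun x => (x, Tm m x) := measurable_id.prodMk (hTm m)
    conv_lhs => rw [hπT m]
    rw [Measure.map_map measurable_snd hg]
    rfl
  have hW : W2sq μ0 μ1 ≠ ⊤ := by
    rw [← hTopt, lintegral_map (by fun_prop) hgT]
    have : ∫⁻ x, ENNReal.ofReal (dist x (T x) ^ 2) ∂μ0 ≤ ∫⁻ _, ENNReal.ofReal (D ^ 2) ∂μ0 := by
      refine lintegral_mono_ae ?_
      filter_upwards [hae0, hTK] with x h1 h2
      have := hD _ h1 _ h2
      gcongr
    refine ne_top_of_le_ne_top ?_ this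
    simp
  have hDκ : Tendsto (fun m => D / κ m) atTop (𝓝 0) := hκtop.const_div_atTop D
  have hcos : Tendsto (fun m => Real.cos (D / κ m)) atTop (𝓝 1) := by
    simpa [Function.comp_def] using (Real.continuous_cos.tendsto 0).comp hDκ
  have hcinv : Tendsto (fun m => (Real.cos (D / κ m))⁻¹) atTop (𝓝 1) := by
    simpa using hcos.inv₀ one_ne_zero
  have he : Tendsto (fun m => ENNReal.ofReal ((2 * D ^ 2 + 1) / κ m)) atTop (𝓝 0) := by
    simpa using ENNReal.tendsto_ofReal (hκtop.const_div_atTop (2 * D ^ 2 + 1))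
  have hCe : ∀ C : ℝ≥0∞, C ≠ ⊤ →
      Tendsto (fun m => C * ENNReal.ofReal ((2 * D ^ 2 + 1) / κ m)) atTop (𝓝 0) := by
    intro C hC
    simpa using ENNReal.Tendsto.const_mul he (Or.inr hC)
  have hlt : ∀ᶠ m in atTop, D / κ m < Real.pi / 2 :=
    hDκ.eventually_lt_const (by positivity)
  have hB := (hκtop.eventually_ge_atTop (2 * D ^ 2 + 1)).and
    (hlt.and (hcos.eventually_const_le (by norm_num : (1 / 2 : ℝ) < 1))) |>.mono
    fun m hm => bounds_of_isMin (π := π m) hD hae0 hae1 hm.1 hm.2.1 hm.2.2 hTfst hTmarg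
      fun π' hπ' => by rw [hπopt m]; exact iInf₂_le π' hπ'
  rw [hTopt] at hB
  have hac : ∀ᶠ m in atTop, μ0 ≪ (π m).map Prod.fst := hB.mono fun m hm =>
    ac_of_pos_le_rnDeriv (Real.exp_pos _) hm.1 hm.2.2.1
  have hSK : ∀ᶠ m in atTop, ∀ᵐ x ∂μ0, Tm m x ∈ K := by
    filter_upwards [hB, hac] with m hm h1 using
      ae_graph_mem hae1 (hTm m) (hsnd m) h1 hm.2.1
  have hM : 1 ≤ 2 * Real.exp 7 := by linarith [Real.add_one_le_exp 7]
  refine ⟨?_, ?_, ?_⟩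
  · obtain ⟨M, hM⟩ := eventually_atTop.1 hB
    refine ⟨M, fun m hm => Measure.singularPart_eq_zero_of_ac ?_⟩
    obtain ⟨_, h1, _, h2, _⟩ := hM m hm
    exact ac_of_pos_le_rnDeriv (Real.exp_pos _) h1 h2
  · have hmarg : ∀ ψ : BoundedContinuousFunction (Eucl n) NNReal,
        Tendsto (fun m => ∫⁻ x, ψ (Tm m x) ∂μ0) atTop (𝓝 (∫⁻ y, ψ y ∂μ1)) := by
      intro ψ
      have hb := hB.mono fun m hm => lintegral_graph_bounds (hTm m) (hsnd m) hm.1 hm.2.1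
        hm.2.2.2.2.2.1 hm.2.2.2.2.2.2.1 (h := fun x => (ψ x : ℝ≥0∞)) (C := (nndist ψ 0 : NNReal))
        ψ.continuous.measurable.coe_nnreal_ennreal
        (fun x => by exact_mod_cast BoundedContinuousFunction.NNReal.upper_bound ψ x)
      refine ENNReal.tendsto_of_le_add_of_le_add ?_ (hb.mono fun m hm => hm.1)
        (hb.mono fun m hm => hm.2)
      simpa only [add_zero] using (hCe _ ENNReal.coe_ne_top).add (hCe _ ENNReal.coe_ne_top)
    have hu : Tendsto (fun m => ENNReal.ofReal (1 + (D / κ m) ^ 2) *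
        (ENNReal.ofReal (Real.cos (D / κ m))⁻¹ * W2sq μ0 μ1)
        + ENNReal.ofReal (D ^ 2) * ENNReal.ofReal ((2 * D ^ 2 + 1) / κ m)) atTop
        (𝓝 (W2sq μ0 μ1)) := by
      have h1 : Tendsto (fun m => ENNReal.ofReal (1 + (D / κ m) ^ 2)) atTop (𝓝 1) := by
        simpa using ENNReal.tendsto_ofReal ((hDκ.pow 2).const_add 1)
      have h2 := ENNReal.Tendsto.mul_const (b := W2sq μ0 μ1) (ENNReal.tendsto_ofReal hcinv)
        (Or.inr hW)
      rw [ENNReal.ofReal_one, one_mul] at h2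
      simpa using (ENNReal.Tendsto.mul h1 (Or.inl one_ne_zero) h2
        (Or.inr ENNReal.one_ne_top)).add (hCe _ ENNReal.ofReal_ne_top)
    have hcost := (hB.and hSK).mono fun m hm => lintegral_sq_dist_graph_le hD hae0 (hκpos m)
      (hTm m) (hπT m) hm.1.1 hm.2 hm.1.2.2.2.2.2.1 hm.1.2.2.2.2.2.2.2
    have hST := tendsto_lintegral_enorm_sub_of_tendsto_map_graph hK hT hTK hTm hSK
      (tendsto_map_graph_of_unique hK hμ0K hμ1K hT hTuniq hTm hSK hmarg hu hcost)
    have hbound := ((hB.and hSK).and (hac.and hlt)).mono fun m hm =>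
      lintegral_velocity_sub_sq_le (hκpos m) hm.2.2
        (Measure.measurable_rnDeriv ((π m).map Prod.fst) μ0).ennreal_toReal
        (fun x => ENNReal.toReal_nonneg) hM hm.1.1.2.2.2.2.1 (hTm m) hT
        (by filter_upwards [hae0, hm.1.2] with x h1 h2 using hD _ h1 _ h2)
        (hm.2.1.ae_le (hv0m m)) hm.1.1.2.2.2.2.2.1
    refine tendsto_of_tendsto_of_tendsto_of_le_of_le' tendsto_const_nhds ?_
      (Eventually.of_forall fun _ => zero_le) hbound
    have hq : Tendsto (fun m => ENNReal.ofReal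
        ((2 * Real.exp 7 * ((Real.cos (D / κ m))⁻¹ - 1)) ^ 2)) atTop (𝓝 0) := by
      have := ENNReal.tendsto_ofReal (((hcinv.sub_const 1).const_mul (2 * Real.exp 7)).pow 2)
      simpa using this
    have h1 := ENNReal.Tendsto.const_mul (a := ENNReal.ofReal (2 * D ^ 2))
      ((hCe (ENNReal.ofReal (2 * Real.exp 7)) ENNReal.ofReal_ne_top).add hq)
      (Or.inr ENNReal.ofReal_ne_top)
    have h2 := (ENNReal.Tendsto.const_mul (a := 2) h1 (Or.inr ENNReal.ofNat_ne_top)).add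
      (ENNReal.Tendsto.const_mul (a := 2) hST (Or.inr ENNReal.ofNat_ne_top))
    simpa only [add_zero, mul_zero] using h2
  · refine tendsto_of_tendsto_of_tendsto_of_le_of_le' tendsto_const_nhds
      (hCe (ENNReal.ofReal (4 * (2 * Real.exp 7))) ENNReal.ofReal_ne_top)
      (Eventually.of_forall fun _ => zero_le) ((hB.and hac).mono fun m hm => ?_)
    exact lintegral_growth_sq_le (fun x => ENNReal.toReal_nonneg) hM hm.1.2.2.2.2.1
      (hm.2.ae_le (hα0m m)) hm.1.2.2.2.2.2.1
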